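/- Assume (h1), (h2), (f1)–(f3), and additionally (nondegeneracy, implicit in the paper) that F(t) > 0 for all t > 0. Then there exists a function u : ℤ^d → ℝ with u(x) > 0 for every x ∈ ℤ^d and ‖u‖_{H_{s,p}} < ∞ such that for every x ∈ ℤ^d all the series involved converge absolutely and (−Δ)_p^s u(x) + h(x)·u(x)^{p−1} = (R_α∗F(u))(x)·f(u(x)). -/

import Mathlib

open MeasureTheory Filter Topology
open scoped ENNReal

noncomputable section

namespace DiscreteChoquard

variable {d : ℕ}

/-- The lattice `ℤ^d`. -/
abbrev Z (d : ℕ) := Fin d → ℤ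

/-- Graph distance on `ℤ^d`, as a real number. -/
def latDist (x y : Z d) : ℝ := ∑ i, |((x i - y i : ℤ) : ℝ)|

/-- The kernel hypotheses on `W_s`: symmetry, positivity, and the two-sided bound
`c|x−y|^{−d−2s} ≤ W_s(x,y) ≤ C|x−y|^{−d−2s}` for `x ≠ y`. -/
def KernelOK (d : ℕ) (s : ℝ) (W : Z d → Z d → ℝ) : Prop :=
  (∀ x y, W x y = W y x) ∧ (∀ x y, 0 < W x y) ∧
  ∃ c C : ℝ, 0 < c ∧ c ≤ C ∧ ∀ x y : Z d, x ≠ y →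
    c * latDist x y ^ (-(d : ℝ) - 2 * s) ≤ W x y ∧
      W x y ≤ C * latDist x y ^ (-(d : ℝ) - 2 * s)

/-- The fractional gradient form `∇^s u ∇^s v (x)`.  (The `y = x` summand vanishes, so we
sum over all `y`.) -/
def gradForm (W : Z d → Z d → ℝ) (u v : Z d → ℝ) (x : Z d) : ℝ :=
  (1 / 2) * ∑' y : Z d, W x y * (u x - u y) * (v x - v y)

/-- `|∇^s u|(x)`. -/
def gradNorm (W : Z d → Z d → ℝ) (u : Z d → ℝ) (x : Z d) : ℝ :=
  Real.sqrt ((1 / 2) * ∑' y : Z d, W x y * (u x - u y) ^ 2)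

/-- The fractional `p`-Laplacian `(−Δ)_p^s u (x)`. -/
def pLap (W : Z d → Z d → ℝ) (p : ℝ) (u : Z d → ℝ) (x : Z d) : ℝ :=
  (1 / 2) * ∑' y : Z d,
    W x y * (gradNorm W u x ^ (p - 2) + gradNorm W u y ^ (p - 2)) * (u x - u y)

/-- `‖u‖_{H_{s,p}}^p = ∑_x (|∇^s u|^p(x) + h(x)|u(x)|^p)`. -/
def HnormP (W : Z d → Z d → ℝ) (h : Z d → ℝ) (p : ℝ) (u : Z d → ℝ) : ℝ :=
  ∑' x : Z d, (gradNorm W u x ^ p + h x * |u x| ^ p)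

/-- `‖u‖_{H_{s,p}}`. -/
def normH (W : Z d → Z d → ℝ) (h : Z d → ℝ) (p : ℝ) (u : Z d → ℝ) : ℝ :=
  HnormP W h p u ^ (1 / p)

/-- Membership `u ∈ H_{s,p}`, i.e. `‖u‖_{H_{s,p}} < ∞` (all the defining series converge). -/
def memH (W : Z d → Z d → ℝ) (h : Z d → ℝ) (p : ℝ) (u : Z d → ℝ) : Prop :=
  (∀ x : Z d, Summable fun y : Z d => W x y * (u x - u y) ^ 2) ∧
  Summable fun x : Z d => gradNorm W u x ^ p + h x * |u x| ^ p

/-- The `ℓ^q` norm on `ℤ^d`. -/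
def lnorm (q : ℝ) (u : Z d → ℝ) : ℝ := (∑' x : Z d, |u x| ^ q) ^ (1 / q)

/-- The torus box `[0, 2π]^d`. -/
def box (d : ℕ) : Set (Fin d → ℝ) := Set.univ.pi fun _ => Set.Icc 0 (2 * Real.pi)

/-- `μ(k) = 2d − 2 ∑_j cos k_j`. -/
def muk (d : ℕ) (k : Fin d → ℝ) : ℝ := 2 * d - 2 * ∑ j, Real.cos (k j)

/-- The fractional degree `K_α = (2π)^{-d} ∫_{[0,2π]^d} μ(k)^{α/2} dk`. -/
def Kfrac (d : ℕ) (α : ℝ) : ℝ :=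
  (2 * Real.pi) ^ (-(d : ℝ)) * ∫ k in box d, muk d k ^ (α / 2)

/-- The Green's function `R_α(x,y)` of the discrete fractional Laplacian. -/
def Riesz (d : ℕ) (α : ℝ) (x y : Z d) : ℝ :=
  Kfrac d α * (2 * Real.pi) ^ (-(d : ℝ)) *
    ∫ k in box d, Real.cos (∑ j, ((x j - y j : ℤ) : ℝ) * k j) * muk d k ^ (-(α / 2))

/-- The convolution `(R_α ∗ v)(x) = ∑_y R_α(x,y) v(y)`. -/
def conv (d : ℕ) (α : ℝ) (v : Z d → ℝ) (x : Z d) : ℝ := ∑' y : Z d, Riesz d α x y * v y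

/-- `F(t) = ∫_0^t f(r) dr`. -/
def Fint (f : ℝ → ℝ) (t : ℝ) : ℝ := ∫ r in (0 : ℝ)..t, f r

/-- Positive part `u⁺ = max(u,0)`. -/
def pos (u : Z d → ℝ) (x : Z d) : ℝ := max (u x) 0

/-- Negative part `u⁻ = min(u,0)`. -/
def negp (u : Z d → ℝ) (x : Z d) : ℝ := min (u x) 0

/-- Hypothesis (h2): `h(x) → ∞` as `|x| → ∞`. -/
def H2 (h : Z d → ℝ) : Prop := Tendsto h cofinite atTop

/-- Hypothesis (f1): `f(t) = o(t^{p−1})` as `t → 0⁺`. -/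
def F1 (f : ℝ → ℝ) (p : ℝ) : Prop :=
  ∀ ε > (0 : ℝ), ∃ δ > (0 : ℝ), ∀ t : ℝ, 0 < t → t < δ → |f t| ≤ ε * t ^ (p - 1)

/-- Hypothesis (f3): `0 ≤ θ F(t) ≤ 2 f(t) t` for `t > 0`. -/
def F3 (f : ℝ → ℝ) (θ : ℝ) : Prop :=
  ∀ t > (0 : ℝ), 0 ≤ θ * Fint f t ∧ θ * Fint f t ≤ 2 * f t * t

/-- The energy functional `J̃`. -/
def energy (W : Z d → Z d → ℝ) (h : Z d → ℝ) (p α : ℝ) (f : ℝ → ℝ) (u : Z d → ℝ) : ℝ :=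
  (1 / p) * HnormP W h p u -
    (1 / 2) * ∑' x : Z d, conv d α (fun y => Fint f (pos u y)) x * Fint f (pos u x)

/-- The Nehari set `M`. -/
def Nehari (W : Z d → Z d → ℝ) (h : Z d → ℝ) (p α : ℝ) (f : ℝ → ℝ) : Set (Z d → ℝ) :=
  {u | memH W h p u ∧ u ≠ 0 ∧
    HnormP W h p u =
      ∑' x : Z d, conv d α (fun y => Fint f (pos u y)) x * f (pos u x) * pos u x}

/-- Hypothesis (f4). -/
def F4 (W : Z d → Z d → ℝ) (h : Z d → ℝ) (p α : ℝ) (f : ℝ → ℝ) : Prop :=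
  ∀ u : Z d → ℝ, memH W h p u → pos u ≠ 0 →
    StrictMonoOn (fun t : ℝ =>
      t ^ (1 - p) *
        ∑' x : Z d, conv d α (fun y => Fint f (t * pos u y)) x * f (t * pos u x) * pos u x)
      (Set.Ioi 0)

/-- The derivative pairing `⟨J̃′(u), φ⟩`. -/
def pairing (W : Z d → Z d → ℝ) (h : Z d → ℝ) (p α : ℝ) (f : ℝ → ℝ) (u φ : Z d → ℝ) : ℝ :=
  (∑' x : Z d,
      (gradNorm W u x ^ (p - 2) * gradForm W u φ x + h x * |u x| ^ (p - 2) * u x * φ x)) -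
    ∑' x : Z d, conv d α (fun y => Fint f (pos u y)) x * f (pos u x) * φ x

/-- A finite-dimensional mountain pass lemma. -/
theorem mountain_pass {E : Type*} [NormedAddCommGroup E] [InnerProductSpace ℝ E]
    [FiniteDimensional ℝ E] (J : E → ℝ) (hJ : ContDiff ℝ 1 J) (N : E → ℝ) (hN : Continuous N)
    {a M r R : ℝ} (ha : 0 < a) (hJ0 : J 0 = 0) (hN0 : N 0 < r)
    (hsph : ∀ u, N u = r → a ≤ J u)
    (hR : ∀ u, R ≤ ‖u‖ → r < N u)
    (hAR : ∀ u, R ≤ ‖u‖ → J u ≤ M + 1 → fderiv ℝ J u u < 0)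
    (e : E) (he : e ≠ 0) (hray : ∀ t : ℝ, 0 ≤ t → J (t • e) ≤ M) :
    ∃ u, fderiv ℝ J u = 0 ∧ a / 2 ≤ J u ∧ J u ≤ M + 1 := by
  classical
  haveI : ProperSpace E := FiniteDimensional.proper ℝ E
  by_contra hcon
  push Not at hcon
  have hJc : Continuous J := hJ.continuous
  have hdc : Continuous (fderiv ℝ J) := hJ.continuous_fderiv (by norm_num)
  have hdiff : Differentiable ℝ J := hJ.differentiable (by norm_num)
  set G : E → E := fun u => (InnerProductSpace.toDual ℝ E).symm (fderiv ℝ J u) with hGdef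
  have hGc : Continuous G := (LinearIsometryEquiv.continuous _).comp hdc
  have hGin : ∀ u v, inner ℝ (G u) v = fderiv ℝ J u v := by
    intro u v; simp [hGdef]
  have hGn : ∀ u, ‖G u‖ = ‖fderiv ℝ J u‖ := by intro u; simp [hGdef]
  -- lower bound of the gradient
  obtain ⟨δ, hδ, hδG⟩ : ∃ δ > 0, ∀ u, ‖u‖ ≤ R → a / 2 ≤ J u → J u ≤ M + 1 → δ ≤ ‖G u‖ := by
    set S : Set E := Metric.closedBall 0 R ∩ {u | a / 2 ≤ J u ∧ J u ≤ M + 1} with hS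
    have hSc : IsCompact S := by
      apply (isCompact_closedBall 0 R).inter_right
      exact (isClosed_le continuous_const hJc).inter (isClosed_le hJc continuous_const)
    rcases S.eq_empty_or_nonempty with h0 | hne
    · refine ⟨1, one_pos, fun u h1 h2 h3 => ?_⟩
      have : u ∈ S := ⟨by simpa using h1, h2, h3⟩
      rw [h0] at this; exact this.elim
    · obtain ⟨v, hv, hmin⟩ := hSc.exists_isMinOn hne (hGc.norm.continuousOn)
      refine ⟨‖G v‖, ?_, fun u h1 h2 h3 => hmin ⟨by simpa using h1, h2, h3⟩⟩
      rw [hGn]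
      apply norm_pos_iff.2
      intro h0
      exact absurd hv.2.2 (not_le.2 (hcon v h0 hv.2.1))
  -- upper bound of the gradient
  obtain ⟨B, hB0, hB⟩ : ∃ B > 0, ∀ u, ‖u‖ ≤ R → ‖G u‖ ≤ B := by
    obtain ⟨B, hB⟩ := (isCompact_closedBall (0 : E) R).exists_bound_of_continuousOn hGc.continuousOn
    exact ⟨max B 1, lt_max_of_lt_right one_pos,
      fun u hu => (hB u (by simpa using hu)).trans (le_max_left _ _)⟩
  -- uniform continuity
  have huc := (isCompact_closedBall (0 : E) (R + 1)).uniformContinuousOn_of_continuous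
    hdc.continuousOn
  rw [Metric.uniformContinuousOn_iff] at huc
  obtain ⟨ω, hω, huω⟩ := huc (δ / 2) (by positivity)
  set h0 : ℝ := min 1 (ω / 2) / B with hh0
  have hh0pos : 0 < h0 := by positivity
  have hdesc : ∀ u, ‖u‖ ≤ R → a / 2 ≤ J u → J u ≤ M + 1 → ∀ t, 0 ≤ t → t ≤ h0 →
      J (u - t • G u) ≤ J u - t * δ ^ 2 / 2 := by
    intro u hu h1 h2 t ht0 ht1
    set ρ : ℝ := min 1 (ω / 2)
    have hρ0 : 0 < ρ := by positivity
    have hstep : ‖(u - t • G u) - u‖ = t * ‖G u‖ := by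
      rw [sub_sub_cancel_left, norm_neg, norm_smul, Real.norm_of_nonneg ht0]
    have hstep' : t * ‖G u‖ ≤ ρ := by
      calc t * ‖G u‖ ≤ h0 * B := by
            apply mul_le_mul ht1 (hB u hu) (norm_nonneg _) hh0pos.le
        _ = ρ := by rw [hh0]; field_simp
    have key := (convex_closedBall u ρ).norm_image_sub_le_of_norm_hasFDerivWithin_le' (f := J)
      (f' := fderiv ℝ J) (φ := fderiv ℝ J u) (C := δ / 2) (x := u) (y := u - t • G u)
      (fun x _ => (hdiff x).hasFDerivAt.hasFDerivWithinAt) ?_ ?_ ?_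
    · have e1 : fderiv ℝ J u ((u - t • G u) - u) = - (t * ‖G u‖ ^ 2) := by
        rw [sub_sub_cancel_left, map_neg, map_smul, ← hGin, real_inner_self_eq_norm_sq]; simp
      rw [e1, hstep, Real.norm_eq_abs] at key
      have k2 := (abs_le.1 key).2
      have hd := hδG u hu h1 h2
      have k3 : δ * (t * ‖G u‖) ≤ t * ‖G u‖ ^ 2 := by
        have := mul_le_mul_of_nonneg_right hd (mul_nonneg ht0 (norm_nonneg (G u)))
        nlinarith
      have k4 : t * δ ^ 2 ≤ t * ‖G u‖ ^ 2 := by gcongr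
      linarith
    · intro x hx
      have hx' : dist x u ≤ ρ := hx
      have := huω x ?_ u ?_ ?_
      · rw [dist_eq_norm] at this; exact this.le
      · have : ‖x‖ ≤ ‖x - u‖ + ‖u‖ := by simpa using norm_add_le (x - u) u
        rw [dist_eq_norm] at hx'
        have : ρ ≤ 1 := min_le_left _ _
        simp; linarith
      · simp; linarith
      · have : ρ ≤ ω / 2 := min_le_right _ _
        linarith
    · simp [hρ0.le]
    · rw [Metric.mem_closedBall, dist_eq_norm, hstep]; exact hstep'
  set η : ℝ → ℝ := fun j => max 0 (min 1 (min ((j - a / 2) * (4 / a)) (2 * (M + 1 - j)))) with hη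
  have hηc : Continuous η := by fun_prop
  have hη0 : ∀ j, 0 ≤ η j := fun j => le_max_left _ _
  have hη1 : ∀ j, η j ≤ 1 := fun j => max_le zero_le_one (min_le_left _ _)
  have hηz1 : ∀ j, j ≤ a / 2 → η j = 0 := by
    intro j hj
    apply max_eq_left
    refine (min_le_right _ _).trans ((min_le_left _ _).trans ?_)
    exact mul_nonpos_of_nonpos_of_nonneg (by linarith) (by positivity)
  have hηz2 : ∀ j, M + 1 ≤ j → η j = 0 := by
    intro j hj
    apply max_eq_left
    refine (min_le_right _ _).trans ((min_le_right _ _).trans ?_)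
    linarith
  have hηo : ∀ j, 3 * a / 4 ≤ j → j ≤ M + 1 / 2 → η j = 1 := by
    intro j h1 h2
    have : (1 : ℝ) ≤ min ((j - a / 2) * (4 / a)) (2 * (M + 1 - j)) := by
      apply le_min
      · rw [← mul_div_assoc, le_div_iff₀ ha]; linarith
      · linarith
    rw [hη]; simp only
    rw [min_eq_left this]; simp
  set Φ : E → E := fun u => u - (h0 * η (J u)) • G u with hΦ
  have hΦc : Continuous Φ := by
    have : Continuous fun u => η (J u) := hηc.comp hJc
    fun_prop
  have hΦout : ∀ u, R ≤ ‖u‖ → ‖u‖ ≤ ‖Φ u‖ := by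
    intro u hu
    by_cases hz : η (J u) = 0
    · simp [hΦ, hz]
    have hle : J u ≤ M + 1 := by
      by_contra hlt; exact hz (hηz2 _ (not_le.1 hlt).le)
    have hneg := hAR u hu hle
    rw [← hGin] at hneg
    have hk : 0 ≤ h0 * η (J u) := mul_nonneg hh0pos.le (hη0 _)
    have : ‖u‖ ^ 2 ≤ ‖Φ u‖ ^ 2 := by
      simp only [hΦ]
      rw [norm_sub_sq_real, inner_smul_right, real_inner_comm]
      nlinarith [sq_nonneg ‖(h0 * η (J u)) • G u‖]
    exact (sq_le_sq₀ (norm_nonneg _) (norm_nonneg _)).1 this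
  -- admissible levels
  set Adm : Set ℝ := {b | ∃ K : Set E, IsPreconnected K ∧ (0 : E) ∈ K ∧ (∃ u ∈ K, R ≤ ‖u‖) ∧
    ∀ u ∈ K, ‖u‖ ≤ R → J u ≤ b} with hAdm
  have hAM : M ∈ Adm := by
    refine ⟨(fun t : ℝ => t • e) '' Set.Ici 0, ?_, ⟨0, by simp, by simp⟩, ?_, ?_⟩
    · exact isPreconnected_Ici.image _ (by fun_prop)
    · refine ⟨(|R| / ‖e‖) • e, ⟨_, by simp; positivity, rfl⟩, ?_⟩
      rw [norm_smul, Real.norm_of_nonneg (by positivity), div_mul_cancel₀ _ (norm_ne_zero_iff.2 he)]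
      exact le_abs_self R
    · rintro _ ⟨t, ht, rfl⟩ _
      exact hray t ht
  have hAa : ∀ b ∈ Adm, a ≤ b := by
    rintro b ⟨K, hK, h0K, ⟨v, hv, hvR⟩, hKb⟩
    obtain ⟨u, hu, hur⟩ := hK.intermediate_value h0K hv hN.continuousOn
      ⟨hN0.le, (hR v hvR).le⟩
    refine (hsph u hur).trans (hKb u hu ?_)
    by_contra hlt
    exact absurd (hR u (not_le.1 hlt).le) (by rw [hur]; exact lt_irrefl _)
  have hbdd : BddBelow Adm := ⟨a, hAa⟩
  set c := sInf Adm with hc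
  have hca : a ≤ c := le_csInf ⟨M, hAM⟩ hAa
  have hcM : c ≤ M := csInf_le hbdd hAM
  have hκ : 0 < min (1 / 2) (h0 * δ ^ 2 / 2) := by positivity
  obtain ⟨b, hb, hbc⟩ := exists_lt_of_csInf_lt (s := Adm) ⟨M, hAM⟩
    (show sInf Adm < c + min (1 / 2) (h0 * δ ^ 2 / 2) by linarith)
  have hb1 : b < c + 1 / 2 := hbc.trans_le (by linarith [min_le_left (1 / 2 : ℝ) (h0 * δ ^ 2 / 2)])
  have hb2 : b < c + h0 * δ ^ 2 / 2 :=
    hbc.trans_le (by linarith [min_le_right (1 / 2 : ℝ) (h0 * δ ^ 2 / 2)])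
  obtain ⟨K, hK, h0K, ⟨v, hv, hvR⟩, hKb⟩ := hb
  have hnew : max (3 * a / 4) (b - h0 * δ ^ 2 / 2) ∈ Adm := by
    refine ⟨Φ '' K, hK.image _ hΦc.continuousOn, ⟨0, h0K, ?_⟩, ⟨Φ v, ⟨v, hv, rfl⟩, ?_⟩, ?_⟩
    · simp [hΦ, hJ0, hηz1 0 (by positivity)]
    · exact hvR.trans (hΦout v hvR)
    · rintro _ ⟨u, hu, rfl⟩ hle
      have huR : ‖u‖ ≤ R := by
        by_contra hlt
        exact hlt ((hΦout u (not_le.1 hlt).le).trans hle)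
      have hub := hKb u hu huR
      by_cases h34 : 3 * a / 4 ≤ J u
      · apply le_max_of_le_right
        have h1 : η (J u) = 1 := hηo _ h34 (by linarith)
        have := hdesc u huR (by linarith) (by linarith) h0 hh0pos.le le_rfl
        simp only [hΦ, h1, mul_one]
        linarith
      · apply le_max_of_le_left
        push Not at h34
        by_cases h2 : a / 2 ≤ J u
        · have := hdesc u huR h2 (by linarith) (h0 * η (J u)) (mul_nonneg hh0pos.le (hη0 _))
            (mul_le_of_le_one_right hh0pos.le (hη1 _))
          have h3 : 0 ≤ (h0 * η (J u)) * δ ^ 2 / 2 := by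
            have := hη0 (J u); positivity
          simp only [hΦ]; linarith
        · push Not at h2
          simp only [hΦ, hηz1 _ h2.le, mul_zero, zero_smul, sub_zero]
          linarith
  have := csInf_le hbdd hnew
  rw [← hc] at this
  rcases le_max_iff.1 this with h1 | h1 <;> linarith

/-- The open torus box. -/
def obox (d : ℕ) : Set (Fin d → ℝ) := Set.univ.pi fun _ => Set.Ioo 0 (2 * Real.pi)

theorem restrict_box : (volume : Measure (Fin d → ℝ)).restrict (box d) = volume.restrict (obox d) := by
  apply Measure.restrict_congr_set
  have := Measure.univ_pi_Ioo_ae_eq_Icc (μ := fun _ : Fin d => (volume : Measure ℝ))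
    (f := fun _ => 0) (g := fun _ => 2 * Real.pi)
  rw [← Set.pi_univ_Icc] at this
  exact this.symm

theorem measurableSet_obox : MeasurableSet (obox d) :=
  MeasurableSet.univ_pi fun _ => measurableSet_Ioo

theorem isOpen_obox : IsOpen (obox d) :=
  isOpen_set_pi Set.finite_univ fun _ _ => isOpen_Ioo

theorem isCompact_box : IsCompact (box d) := isCompact_univ_pi fun _ => isCompact_Icc

theorem volume_obox_pos : 0 < (volume : Measure (Fin d → ℝ)) (obox d) := by
  refine isOpen_obox.measure_pos volume ?_
  refine ⟨fun _ => Real.pi, fun i _ => ⟨Real.pi_pos, by linarith [Real.pi_pos]⟩⟩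

theorem integrable_obox_of_continuous {g : (Fin d → ℝ) → ℝ} (hg : Continuous g) :
    Integrable g (volume.restrict (obox d)) := by
  rw [← restrict_box]
  exact hg.continuousOn.integrableOn_compact isCompact_box

theorem integral_obox_pos {g : (Fin d → ℝ) → ℝ} (hg : Integrable g (volume.restrict (obox d)))
    (hpos : ∀ k ∈ obox d, 0 < g k) : 0 < ∫ k in obox d, g k := by
  rw [setIntegral_pos_iff_support_of_nonneg_ae _ hg]
  · have : Function.support g ∩ obox d = obox d :=
      Set.inter_eq_right.2 fun k hk => (hpos k hk).ne'
    rw [this]; exact volume_obox_pos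
  · filter_upwards [ae_restrict_mem measurableSet_obox] with k hk using (hpos k hk).le

theorem one_dim_bound {t γ : ℝ} (hγ : 0 < γ) (ht : t ∈ Set.Ioo 0 (2 * Real.pi)) :
    (2 - 2 * Real.cos t) ^ (-γ) ≤
      (4 / Real.pi ^ 2) ^ (-γ) * (t ^ (-(2 * γ)) + (2 * Real.pi - t) ^ (-(2 * γ))) := by
  have hpi := Real.pi_pos
  obtain ⟨h1, h2⟩ := ht
  have h3 : 0 < 2 * Real.pi - t := by linarith
  have aux : ∀ s : ℝ, 0 < s → s ≤ Real.pi →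
      (2 - 2 * Real.cos s) ^ (-γ) ≤ (4 / Real.pi ^ 2) ^ (-γ) * s ^ (-(2 * γ)) := by
    intro s hs hs2
    have e : s ^ (-(2 * γ)) = (s ^ 2) ^ (-γ) := by
      rw [← Real.rpow_natCast, ← Real.rpow_mul hs.le]; congr 1; push_cast; ring
    rw [e, ← Real.mul_rpow (by positivity) (by positivity)]
    apply Real.rpow_le_rpow_of_nonpos (by positivity) _ (by linarith)
    have := Real.cos_le_one_sub_mul_cos_sq (x := s) (by rw [abs_of_pos hs]; exact hs2)
    have h5 : 4 / Real.pi ^ 2 * s ^ 2 = 2 * (2 / Real.pi ^ 2 * s ^ 2) := by ring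
    linarith
  have hc : 0 ≤ (4 / Real.pi ^ 2) ^ (-γ) := by positivity
  rw [mul_add]
  by_cases hle : t ≤ Real.pi
  · have := aux t h1 hle
    have : 0 ≤ (4 / Real.pi ^ 2) ^ (-γ) * (2 * Real.pi - t) ^ (-(2 * γ)) := by positivity
    linarith
  · have := aux (2 * Real.pi - t) h3 (by linarith)
    rw [Real.cos_two_pi_sub] at this
    have : 0 ≤ (4 / Real.pi ^ 2) ^ (-γ) * t ^ (-(2 * γ)) := by positivity
    linarith

theorem one_dim_integrable {γ : ℝ} (hγ : 0 < γ) (hγ1 : 2 * γ < 1) :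
    Integrable (fun t => (2 - 2 * Real.cos t) ^ (-γ))
      (volume.restrict (Set.Ioo 0 (2 * Real.pi))) := by
  have hpi := Real.pi_pos
  have i1 : Integrable (fun t : ℝ => t ^ (-(2 * γ))) (volume.restrict (Set.Ioo 0 (2 * Real.pi))) := by
    have := (intervalIntegral.intervalIntegrable_rpow' (a := 0) (b := 2 * Real.pi)
      (r := -(2 * γ)) (by linarith))
    rw [intervalIntegrable_iff_integrableOn_Ioo_of_le (by positivity)] at this
    exact this
  have i2 : Integrable (fun t : ℝ => (2 * Real.pi - t) ^ (-(2 * γ)))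
      (volume.restrict (Set.Ioo 0 (2 * Real.pi))) := by
    have := (intervalIntegral.intervalIntegrable_rpow' (a := 0) (b := 2 * Real.pi)
      (r := -(2 * γ)) (by linarith)).comp_sub_left (2 * Real.pi)
    simp only [sub_zero, sub_self] at this
    have := this.symm
    rw [intervalIntegrable_iff_integrableOn_Ioo_of_le (by positivity)] at this
    exact this
  refine ((i1.add i2).const_mul ((4 / Real.pi ^ 2) ^ (-γ))).mono' ?_ ?_
  · apply Measurable.aestronglyMeasurable
    fun_prop
  · filter_upwards [ae_restrict_mem measurableSet_Ioo] with t ht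
    rw [Real.norm_of_nonneg]
    · exact one_dim_bound hγ ht
    · apply Real.rpow_nonneg; linarith [Real.cos_le_one t]

theorem muk_eq (k : Fin d → ℝ) : muk d k = ∑ j, (2 - 2 * Real.cos (k j)) := by
  simp [muk, Finset.sum_sub_distrib, Finset.mul_sum, mul_comm]

theorem muk_nonneg (k : Fin d → ℝ) : 0 ≤ muk d k := by
  rw [muk_eq]
  exact Finset.sum_nonneg fun j _ => by linarith [Real.cos_le_one (k j)]

theorem cos_lt_one_of_mem {t : ℝ} (ht : t ∈ Set.Ioo 0 (2 * Real.pi)) : Real.cos t < 1 := by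
  refine lt_of_le_of_ne (Real.cos_le_one t) fun h => ?_
  have := (Real.cos_eq_one_iff_of_lt_of_lt (by linarith [ht.1, Real.pi_pos]) ht.2).1 h
  exact ht.1.ne' this

theorem muk_pos (hd : 0 < d) {k : Fin d → ℝ} (hk : k ∈ obox d) : 0 < muk d k := by
  rw [muk_eq]
  have : Nonempty (Fin d) := ⟨⟨0, hd⟩⟩
  exact Finset.sum_pos (fun j _ => by linarith [cos_lt_one_of_mem (hk j trivial)])
    Finset.univ_nonempty

theorem continuous_muk : Continuous (muk d) := by
  unfold muk; fun_prop

theorem integrable_muk (hd : 0 < d) {α : ℝ} (hα : α ∈ Set.Ioo (0 : ℝ) (d : ℝ)) :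
    Integrable (fun k => muk d k ^ (-(α / 2))) (volume.restrict (obox d)) := by
  have hd' : (0 : ℝ) < d := by exact_mod_cast hd
  set γ : ℝ := α / (2 * d) with hγ
  have hγ0 : 0 < γ := by have := hα.1; positivity
  have hγ1 : 2 * γ < 1 := by
    have : 2 * γ = α / d := by rw [hγ]; field_simp
    rw [this, div_lt_one hd']; exact hα.2
  have hI : Integrable (fun k : Fin d → ℝ => ∏ j, (2 - 2 * Real.cos (k j)) ^ (-γ))
      (volume.restrict (obox d)) := by
    rw [volume_pi, obox, Measure.restrict_pi_pi]
    exact Integrable.fintype_prod (f := fun _ t => (2 - 2 * Real.cos t) ^ (-γ))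
      fun _ => one_dim_integrable hγ0 hγ1
  refine hI.mono' ?_ ?_
  · apply Measurable.aestronglyMeasurable
    have := (continuous_muk (d := d)).measurable
    fun_prop
  · filter_upwards [ae_restrict_mem measurableSet_obox] with k hk
    have hm := muk_pos hd hk
    rw [Real.norm_of_nonneg (by positivity)]
    have e : muk d k ^ (-(α / 2)) = ∏ _j : Fin d, muk d k ^ (-γ) := by
      rw [Finset.prod_const, Finset.card_univ, Fintype.card_fin, ← Real.rpow_natCast,
        ← Real.rpow_mul hm.le]
      congr 1; rw [hγ]; field_simp
    rw [e]
    apply Finset.prod_le_prod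
    · intro j _; positivity
    · intro j _
      have h1 := cos_lt_one_of_mem (hk j trivial)
      apply Real.rpow_le_rpow_of_nonpos (by linarith) _ (by linarith)
      rw [muk_eq]
      exact Finset.single_le_sum (f := fun j => 2 - 2 * Real.cos (k j))
        (fun i _ => by linarith [Real.cos_le_one (k i)]) (Finset.mem_univ j)

/-- the phase `x · k`. -/
def phase (x : Z d) (k : Fin d → ℝ) : ℝ := ∑ j, ((x j : ℤ) : ℝ) * k j

theorem continuous_phase (x : Z d) : Continuous (phase x) := by unfold phase; fun_prop

theorem base_nonneg (x : Z d) : 0 ≤ ∫ k in obox d, Real.cos (phase x k) := by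
  have h1 : ∀ k : Fin d → ℝ, ((Real.cos (phase x k) : ℝ)) =
      (∏ j, Complex.exp ((x j : ℂ) * Complex.I * (k j : ℂ))).re := by
    intro k
    rw [← Complex.exp_sum]
    have : ∑ j, (x j : ℂ) * Complex.I * (k j : ℂ) = (phase x k : ℂ) * Complex.I := by
      simp only [phase, Complex.ofReal_sum, Finset.sum_mul]
      refine Finset.sum_congr rfl fun j _ => ?_
      push_cast; ring
    rw [this, Complex.exp_ofReal_mul_I_re]
  have h2 : ∫ k in obox d, (∏ j, Complex.exp ((x j : ℂ) * Complex.I * (k j : ℂ))) =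
      ∏ j, ∫ t in Set.Ioo 0 (2 * Real.pi), Complex.exp ((x j : ℂ) * Complex.I * (t : ℂ)) := by
    rw [volume_pi, obox, Measure.restrict_pi_pi]
    exact integral_fintype_prod_eq_prod
      (fun j (t : ℝ) => Complex.exp ((x j : ℂ) * Complex.I * (t : ℂ)))
  have h3 : ∀ n : ℤ, ∃ r : ℝ, 0 ≤ r ∧
      ∫ t in Set.Ioo 0 (2 * Real.pi), Complex.exp ((n : ℂ) * Complex.I * (t : ℂ)) = (r : ℂ) := by
    intro n
    by_cases hn : n = 0
    · refine ⟨2 * Real.pi, by positivity, ?_⟩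
      subst hn
      simp [Real.pi_pos.le]
    · refine ⟨0, le_rfl, ?_⟩
      rw [← integral_Ioc_eq_integral_Ioo,
        ← intervalIntegral.integral_of_le (by positivity), integral_exp_mul_complex]
      · have : (n : ℂ) * Complex.I * ((2 * Real.pi : ℝ) : ℂ) = n * (2 * Real.pi * Complex.I) := by
          push_cast; ring
        rw [this, Complex.exp_int_mul_two_pi_mul_I]
        simp
      · simp [hn]
  choose r hr0 hr using h3
  have h4 : Integrable (fun k : Fin d → ℝ => ∏ j, Complex.exp ((x j : ℂ) * Complex.I * (k j : ℂ)))
      (volume.restrict (obox d)) := by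
    rw [← restrict_box]
    refine ContinuousOn.integrableOn_compact isCompact_box (Continuous.continuousOn ?_)
    fun_prop
  simp_rw [h1]
  have h5 := integral_re h4
  simp only [RCLike.re_to_complex] at h5
  rw [h5, h2]
  simp_rw [hr]
  rw [← Complex.ofReal_prod, Complex.ofReal_re]
  exact Finset.prod_nonneg fun j _ => hr0 _

/-- sum of cosines -/
def csum (k : Fin d → ℝ) : ℝ := ∑ j, Real.cos (k j)

theorem continuous_csum : Continuous (csum (d := d)) := by unfold csum; fun_prop

theorem abs_csum_le (k : Fin d → ℝ) : |csum k| ≤ d := by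
  refine (Finset.abs_sum_le_sum_abs _ _).trans ?_
  refine (Finset.sum_le_sum fun j _ => Real.abs_cos_le_one (k j)).trans ?_
  simp

theorem pow_nonneg' (n : ℕ) : ∀ x : Z d, 0 ≤ ∫ k in obox d, Real.cos (phase x k) * csum k ^ n := by
  induction n with
  | zero => intro x; simpa using base_nonneg x
  | succ n ih =>
    intro x
    have hp : ∀ (j : Fin d) (c : ℤ) (k : Fin d → ℝ),
        phase (x + Pi.single j c) k = phase x k + c * k j := by
      intro j c k
      simp only [phase, Pi.add_apply, Int.cast_add, add_mul, Finset.sum_add_distrib]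
      congr 1
      rw [Finset.sum_eq_single j]
      · simp
      · intro b _ hb; simp [hb]
      · simp
    have e : ∀ k : Fin d → ℝ, Real.cos (phase x k) * csum k ^ (n + 1) =
        ∑ j, (1 / 2 * (Real.cos (phase (x + Pi.single j 1) k) * csum k ^ n) +
          1 / 2 * (Real.cos (phase (x + Pi.single j (-1)) k) * csum k ^ n)) := by
      intro k
      rw [pow_succ]
      conv_lhs => rw [show csum k = ∑ j, Real.cos (k j) from rfl]
      rw [← mul_assoc, Finset.mul_sum]
      refine Finset.sum_congr rfl fun j _ => ?_
      rw [hp, hp]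
      push_cast
      rw [show phase x k + -1 * k j = phase x k - k j by ring, one_mul, Real.cos_add, Real.cos_sub]
      simp only [csum]
      ring
    simp_rw [e]
    have hc : ∀ y : Z d, Integrable (fun k => 1 / 2 * (Real.cos (phase y k) * csum k ^ n))
        (volume.restrict (obox d)) := by
      intro y
      apply integrable_obox_of_continuous
      have := continuous_phase y
      have := continuous_csum (d := d)
      fun_prop
    have hc2 : ∀ j ∈ (Finset.univ : Finset (Fin d)), Integrable
        (fun k => 1 / 2 * (Real.cos (phase (x + Pi.single j 1) k) * csum k ^ n) +
          1 / 2 * (Real.cos (phase (x + Pi.single j (-1)) k) * csum k ^ n))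
        (volume.restrict (obox d)) := fun j _ => (hc (x + Pi.single j 1)).add (hc (x + Pi.single j (-1)))
    rw [integral_finsetSum _ hc2]
    refine Finset.sum_nonneg fun j _ => ?_
    rw [integral_add (hc (x + Pi.single j 1)) (hc (x + Pi.single j (-1))), integral_const_mul, integral_const_mul]
    have := ih (x + Pi.single j 1)
    have := ih (x + Pi.single j (-1))
    positivity

theorem choose_nonneg' {a : ℝ} (ha : 0 < a) (n : ℕ) : 0 ≤ Ring.choose (a + n - 1) n := by
  have h : Ring.choose (a + n - 1) n = Ring.multichoose a n := by
    rw [Ring.choose]; congr 1; ring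
  rw [h]
  have h2 := Ring.factorial_nsmul_multichoose_eq_ascPochhammer a n
  rw [Polynomial.ascPochhammer_smeval_eq_eval, nsmul_eq_mul] at h2
  have h3 := ascPochhammer_pos n a ha
  have h4 : (0 : ℝ) < n.factorial := by exact_mod_cast n.factorial_pos
  rw [← h2] at h3
  exact (pos_of_mul_pos_right h3 h4.le).le

theorem hasSum_binom {a t : ℝ} (ht : |t| < 1) :
    HasSum (fun n : ℕ => Ring.choose (a + n - 1) n * t ^ n) (1 / (1 - t) ^ a) := by
  have h := (Real.one_div_one_sub_rpow_hasFPowerSeriesOnBall_zero a).hasSum (y := t) (by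
    simp [Metric.mem_eball, edist_dist, ht])
  simpa [FormalMultilinearSeries.ofScalars, mul_comm] using h

theorem approx_nonneg (hd : 0 < d) {a r : ℝ} (ha : 0 < a) (hr0 : 0 ≤ r) (hr1 : r < 1) (x : Z d) :
    0 ≤ ∫ k in obox d, Real.cos (phase x k) * (1 / (1 - r * (csum k / d)) ^ a) := by
  have hd' : (0 : ℝ) < d := by exact_mod_cast hd
  have hle : ∀ k : Fin d → ℝ, |r * (csum k / d)| ≤ r := by
    intro k
    rw [abs_mul, abs_of_nonneg hr0, abs_div, abs_of_pos hd']
    exact mul_le_of_le_one_right hr0 ((div_le_one hd').2 (abs_csum_le k))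
  set Fn : ℕ → (Fin d → ℝ) → ℝ := fun n k =>
    Real.cos (phase x k) * (Ring.choose (a + n - 1) n * (r * (csum k / d)) ^ n) with hFn
  have hFi : ∀ n, Integrable (Fn n) (volume.restrict (obox d)) := by
    intro n
    apply integrable_obox_of_continuous
    have := continuous_phase x
    have := continuous_csum (d := d)
    simp only [hFn]
    fun_prop
  have hfin : IsFiniteMeasure ((volume : Measure (Fin d → ℝ)).restrict (obox d)) := by
    rw [← restrict_box]
    exact ⟨by rw [Measure.restrict_apply_univ]; exact isCompact_box.measure_lt_top⟩
  have hsum : Summable fun n => ∫ k in obox d, ‖Fn n k‖ := by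
    have hs := (hasSum_binom (a := a) (t := r) (by rwa [abs_of_nonneg hr0])).summable
    refine Summable.of_nonneg_of_le (fun n => integral_nonneg fun _ => norm_nonneg _) (fun n => ?_)
      (hs.mul_left ((volume : Measure (Fin d → ℝ)).real (obox d)))
    have : ∫ k in obox d, ‖Fn n k‖ ≤ ∫ k in obox d, (Ring.choose (a + n - 1) n * r ^ n) := by
      apply integral_mono (hFi n).norm (integrable_const _)
      intro k
      simp only [hFn, norm_mul, Real.norm_eq_abs, abs_pow]
      rw [abs_of_nonneg (choose_nonneg' ha n)]
      have h1 := Real.abs_cos_le_one (phase x k)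
      have h2 : |r| * |csum k / d| ≤ r := by rw [← abs_mul]; exact hle k
      have h3 := choose_nonneg' ha n
      calc |Real.cos (phase x k)| * (Ring.choose (a + n - 1) n * |r * (csum k / d)| ^ n)
          ≤ 1 * (Ring.choose (a + n - 1) n * r ^ n) := by
            gcongr
            exact hle k
        _ = _ := one_mul _
    refine this.trans_eq ?_
    rw [integral_const]; simp [Measure.real]
  have key := hasSum_integral_of_summable_integral_norm hFi hsum
  have e : ∀ k, ∑' n, Fn n k = Real.cos (phase x k) * (1 / (1 - r * (csum k / d)) ^ a) := by
    intro k
    exact ((hasSum_binom (a := a) ((hle k).trans_lt hr1)).mul_left _).tsum_eq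
  simp_rw [e] at key
  refine key.nonneg fun n => ?_
  have e2 : ∀ k, Fn n k = (Ring.choose (a + n - 1) n * (r / d) ^ n) *
      (Real.cos (phase x k) * csum k ^ n) := by
    intro k; simp only [hFn]; rw [show r * (csum k / d) = r / d * csum k by ring, mul_pow]; ring
  simp_rw [e2]
  rw [integral_const_mul]
  exact mul_nonneg (mul_nonneg (choose_nonneg' ha n) (by positivity)) (pow_nonneg' n x)

theorem muk_csum (hd : 0 < d) (k : Fin d → ℝ) : muk d k = 2 * d * (1 - csum k / d) := by
  have hd' : (0 : ℝ) < d := by exact_mod_cast hd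
  rw [muk, csum]; field_simp

theorem riesz_int_nonneg (hd : 0 < d) {α : ℝ} (hα : α ∈ Set.Ioo (0 : ℝ) (d : ℝ)) (x : Z d) :
    0 ≤ ∫ k in obox d, Real.cos (phase x k) * muk d k ^ (-(α / 2)) := by
  have hd' : (0 : ℝ) < d := by exact_mod_cast hd
  have hα0 := hα.1
  have hfin : IsFiniteMeasure ((volume : Measure (Fin d → ℝ)).restrict (obox d)) := by
    rw [← restrict_box]
    exact ⟨by rw [Measure.restrict_apply_univ]; exact isCompact_box.measure_lt_top⟩
  set a := α / 2 with ha
  have ha0 : 0 < a := by positivity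
  have hbase : ∀ k, muk d k ^ (-a) = (2 * (d : ℝ)) ^ (-a) * (1 - csum k / d) ^ (-a) := by
    intro k
    rw [muk_csum hd, Real.mul_rpow (by positivity)]
    have := muk_nonneg k
    rw [muk_csum hd] at this
    exact nonneg_of_mul_nonneg_right this (by positivity)
  have hI : Integrable (fun k : Fin d → ℝ => (1 - csum k / d) ^ (-a))
      (volume.restrict (obox d)) := by
    have := (integrable_muk hd hα).const_mul ((2 * (d : ℝ)) ^ a)
    refine this.congr (Eventually.of_forall fun k => ?_)
    simp only
    rw [← ha, hbase, ← mul_assoc, ← Real.rpow_add (by positivity)]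
    simp
  set r : ℕ → ℝ := fun n => 1 - 1 / ((n : ℝ) + 1) with hr
  have hr0 : ∀ n, 0 ≤ r n := by
    intro n
    have : 1 / ((n : ℝ) + 1) ≤ 1 := by
      rw [div_le_one (by positivity)]; linarith [Nat.cast_nonneg (α := ℝ) n]
    simp only [hr]; linarith
  have hr1 : ∀ n, r n < 1 := by
    intro n
    have : 0 < 1 / ((n : ℝ) + 1) := by positivity
    simp only [hr]; linarith
  have hrt : Tendsto r atTop (𝓝 1) := by
    simpa [hr] using (tendsto_const_nhds (x := (1 : ℝ))).sub tendsto_one_div_add_atTop_nhds_zero_nat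
  have hlim := tendsto_integral_of_dominated_convergence
    (μ := volume.restrict (obox d))
    (F := fun n k => Real.cos (phase x k) * (1 / (1 - r n * (csum k / d)) ^ a))
    (f := fun k => Real.cos (phase x k) * (1 - csum k / d) ^ (-a))
    (fun k => (1 - csum k / d) ^ (-a) + 1) ?_ (hI.add (integrable_const _)) ?_ ?_
  · have h1 := ge_of_tendsto' hlim fun n => approx_nonneg hd ha0 (hr0 n) (hr1 n) x
    simp_rw [hbase]
    have e : ∀ k, Real.cos (phase x k) * ((2 * (d : ℝ)) ^ (-a) * (1 - csum k / d) ^ (-a)) =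
      (2 * (d : ℝ)) ^ (-a) * (Real.cos (phase x k) * (1 - csum k / d) ^ (-a)) := by
      intro k; ring
    simp_rw [e]
    rw [integral_const_mul]
    positivity
  · intro n
    apply Measurable.aestronglyMeasurable
    have := (continuous_phase x).measurable
    have := (continuous_csum (d := d)).measurable
    fun_prop
  · intro n
    filter_upwards [ae_restrict_mem measurableSet_obox] with k hk
    have hm := muk_pos hd hk
    rw [muk_csum hd] at hm
    have hc : 0 < 1 - csum k / d := pos_of_mul_pos_right hm (by positivity)
    have hb1 : 0 < 1 - r n * (csum k / d) := by nlinarith [hr0 n, hr1 n]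
    rw [norm_mul, Real.norm_eq_abs, Real.norm_eq_abs, one_div, ← Real.rpow_neg hb1.le,
      abs_of_pos (Real.rpow_pos_of_pos hb1 _)]
    have h1 := Real.abs_cos_le_one (phase x k)
    have h2 : 0 < (1 - r n * (csum k / d)) ^ (-a) := Real.rpow_pos_of_pos hb1 _
    have h4 : 0 < (1 - csum k / d) ^ (-a) := Real.rpow_pos_of_pos hc _
    have h3 : (1 - r n * (csum k / d)) ^ (-a) ≤ (1 - csum k / d) ^ (-a) + 1 := by
      by_cases hs : 0 ≤ csum k / d
      · have : (1 - r n * (csum k / d)) ^ (-a) ≤ (1 - csum k / d) ^ (-a) := by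
          apply Real.rpow_le_rpow_of_nonpos hc _ (by linarith)
          nlinarith [hr0 n, hr1 n]
        linarith
      · have : (1 - r n * (csum k / d)) ^ (-a) ≤ 1 := by
          apply Real.rpow_le_one_of_one_le_of_nonpos _ (by linarith)
          nlinarith [hr0 n, hr1 n]
        linarith
    nlinarith
  · filter_upwards [ae_restrict_mem measurableSet_obox] with k hk
    have hm := muk_pos hd hk
    rw [muk_csum hd] at hm
    have hc : 0 < 1 - csum k / d := pos_of_mul_pos_right hm (by positivity)
    apply Tendsto.const_mul
    have h1 : Tendsto (fun n => 1 - r n * (csum k / d)) atTop (𝓝 (1 - 1 * (csum k / d))) :=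
      tendsto_const_nhds.sub (hrt.mul_const _)
    rw [one_mul] at h1
    have h2 := (h1.rpow_const (p := a) (Or.inl hc.ne'))
    have h3 := h2.inv₀ (Real.rpow_pos_of_pos hc _).ne'
    rw [← Real.rpow_neg hc.le] at h3
    simpa using h3

theorem kfrac_pos (hd : 0 < d) {α : ℝ} (hα : α ∈ Set.Ioo (0 : ℝ) (d : ℝ)) : 0 < Kfrac d α := by
  unfold Kfrac
  rw [restrict_box]
  have hα0 := hα.1
  apply mul_pos (by positivity)
  apply integral_obox_pos
  · apply integrable_obox_of_continuous
    exact continuous_muk.rpow_const fun k => Or.inr (by positivity)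
  · intro k hk
    exact Real.rpow_pos_of_pos (muk_pos hd hk) _

theorem riesz_eq {α : ℝ} (x y : Z d) : Riesz d α x y = Kfrac d α * (2 * Real.pi) ^ (-(d : ℝ)) *
    ∫ k in obox d, Real.cos (phase (x - y) k) * muk d k ^ (-(α / 2)) := by
  unfold Riesz
  rw [restrict_box]
  rfl

theorem riesz_nonneg (hd : 0 < d) {α : ℝ} (hα : α ∈ Set.Ioo (0 : ℝ) (d : ℝ)) (x y : Z d) :
    0 ≤ Riesz d α x y := by
  rw [riesz_eq]
  have := kfrac_pos hd hα
  exact mul_nonneg (by positivity) (riesz_int_nonneg hd hα _)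

theorem riesz_symm {α : ℝ} (x y : Z d) : Riesz d α x y = Riesz d α y x := by
  rw [riesz_eq, riesz_eq]
  have : ∀ k, phase (x - y) k = - phase (y - x) k := by
    intro k
    simp only [phase, ← Finset.sum_neg_distrib]
    refine Finset.sum_congr rfl fun j _ => ?_
    simp only [Pi.sub_apply]; push_cast; ring
  simp_rw [this, Real.cos_neg]

theorem riesz_pos (hd : 0 < d) {α : ℝ} (hα : α ∈ Set.Ioo (0 : ℝ) (d : ℝ)) :
    0 < Riesz d α 0 0 := by
  rw [riesz_eq]
  have := kfrac_pos hd hα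
  apply mul_pos (by positivity)
  have e : ∀ k, phase (0 - 0 : Z d) k = 0 := by intro k; simp [phase]
  simp_rw [e, Real.cos_zero, one_mul]
  exact integral_obox_pos (integrable_muk hd hα) fun k hk => Real.rpow_pos_of_pos (muk_pos hd hk) _

theorem riesz_le (hd : 0 < d) {α : ℝ} (hα : α ∈ Set.Ioo (0 : ℝ) (d : ℝ)) (x y : Z d) :
    Riesz d α x y ≤ Riesz d α 0 0 := by
  rw [riesz_eq, riesz_eq]
  have := kfrac_pos hd hα
  apply mul_le_mul_of_nonneg_left _ (by positivity)
  have e : ∀ k, phase (0 - 0 : Z d) k = 0 := by intro k; simp [phase]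
  simp_rw [e, Real.cos_zero, one_mul]
  have hb : ∀ k, |Real.cos (phase (x - y) k) * muk d k ^ (-(α / 2))| ≤ muk d k ^ (-(α / 2)) := by
    intro k
    have h0 : 0 ≤ muk d k ^ (-(α / 2)) := Real.rpow_nonneg (muk_nonneg k) _
    rw [abs_mul, abs_of_nonneg h0]
    exact mul_le_of_le_one_left h0 (Real.abs_cos_le_one _)
  refine integral_mono ((integrable_muk hd hα).mono' ?_ (Eventually.of_forall hb))
    (integrable_muk hd hα) fun k => (le_abs_self _).trans (hb k)
  apply Measurable.aestronglyMeasurable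
  have := (continuous_phase (x - y)).measurable
  have := (continuous_muk (d := d)).measurable
  fun_prop

theorem summable_lat (hd : 0 < d) {s : ℝ} (hs : 0 < s) :
    Summable fun z : Z d => latDist z 0 ^ (-(d : ℝ) - 2 * s) := by
  have hd' : (0 : ℝ) < d := by exact_mod_cast hd
  set b := Pi.basisFun ℝ (Fin d) with hb
  set L : Submodule ℤ (Fin d → ℝ) := Submodule.span ℤ (Set.range b) with hL
  have hfr : Module.finrank ℤ L = d := by
    rw [ZLattice.rank ℝ L]; simp
  have hsum := ZLattice.summable_norm_rpow L (-(d : ℝ) - 2 * s) (by rw [hfr]; linarith)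
  have hmem : ∀ z : Z d, (fun i => (z i : ℝ)) ∈ L := by
    intro z
    rw [hL, Module.Basis.mem_span_iff_repr_mem ℤ b]
    intro i
    exact ⟨z i, by simp [hb]⟩
  set φ : Z d → L := fun z => ⟨fun i => (z i : ℝ), hmem z⟩ with hφ
  have hinj : Function.Injective φ := by
    intro z w h
    have h1 := congrArg Subtype.val h
    funext i
    have := congrFun h1 i
    simpa [hφ] using this
  have h2 := hsum.comp_injective hinj
  refine Summable.of_nonneg_of_le (fun z => ?_) (fun z => ?_) h2
  · exact Real.rpow_nonneg (Finset.sum_nonneg fun _ _ => abs_nonneg _) _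
  · simp only [Function.comp]
    have hle : ‖φ z‖ ≤ latDist z 0 := by
      have : ‖φ z‖ = ‖(fun i => (z i : ℝ))‖ := rfl
      have hl0 : 0 ≤ latDist z 0 := Finset.sum_nonneg fun _ _ => abs_nonneg _
      rw [this, pi_norm_le_iff_of_nonneg hl0]
      intro i
      rw [Real.norm_eq_abs]
      have := Finset.single_le_sum (f := fun i => |((z i - (0 : Z d) i : ℤ) : ℝ)|)
        (fun _ _ => abs_nonneg _) (Finset.mem_univ i)
      simpa [latDist] using this
    by_cases hz : ‖φ z‖ = 0
    · have hz0 : z = 0 := by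
        apply hinj
        rw [norm_eq_zero.1 hz]
        ext i; simp [hφ]
      subst hz0
      have h3 : latDist (0 : Z d) 0 = 0 := by simp [latDist]
      rw [h3, hz]
    · exact Real.rpow_le_rpow_of_nonpos (lt_of_le_of_ne (norm_nonneg _) (Ne.symm hz)) hle (by linarith)

/-- Off-diagonal kernel. -/
def offW (W : Z d → Z d → ℝ) (x y : Z d) : ℝ := if x = y then 0 else W x y

theorem latDist_sub (x y : Z d) : latDist x y = latDist (x - y) 0 := by
  simp [latDist]

theorem offW_props (hd : 0 < d) {s : ℝ} (hs : 0 < s) {W : Z d → Z d → ℝ} (hW : KernelOK d s W) :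
    (∀ x y, offW W x y = offW W y x) ∧ (∀ x y, 0 ≤ offW W x y) ∧
    (∀ x y, x ≠ y → 0 < offW W x y) ∧
    ∃ S : ℝ, 0 < S ∧ ∀ x, Summable (offW W x) ∧ ∑' y, offW W x y ≤ S := by
  obtain ⟨h1, h2, c, C, hc, hcC, hb⟩ := hW
  have hC : 0 < C := hc.trans_le hcC
  have hnn : ∀ x y, 0 ≤ offW W x y := by
    intro x y
    unfold offW; split_ifs
    · exact le_rfl
    · exact (h2 x y).le
  refine ⟨?_, hnn, ?_, ?_⟩
  · intro x y
    unfold offW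
    by_cases h : x = y
    · simp [h]
    · rw [if_neg h, if_neg (Ne.symm h), h1]
  · intro x y h
    unfold offW; rw [if_neg h]; exact h2 x y
  · have hs1 := (summable_lat hd hs).mul_left C
    have hnn2 : ∀ z : Z d, 0 ≤ C * latDist z 0 ^ (-(d : ℝ) - 2 * s) := fun z =>
      mul_nonneg hC.le (Real.rpow_nonneg (Finset.sum_nonneg fun _ _ => abs_nonneg _) _)
    have hle : ∀ x y, offW W x y ≤ C * latDist (x - y) 0 ^ (-(d : ℝ) - 2 * s) := by
      intro x y
      unfold offW
      split_ifs with h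
      · exact hnn2 _
      · rw [← latDist_sub]; exact (hb x y h).2
    refine ⟨(∑' z : Z d, C * latDist z 0 ^ (-(d : ℝ) - 2 * s)) + 1,
      add_pos_of_nonneg_of_pos (tsum_nonneg hnn2) one_pos, fun x => ?_⟩
    have hs2 : Summable fun y : Z d => C * latDist (x - y) 0 ^ (-(d : ℝ) - 2 * s) :=
      ((Equiv.subLeft x).summable_iff
        (f := fun z : Z d => C * latDist z 0 ^ (-(d : ℝ) - 2 * s))).2 hs1
    have hs3 : Summable (offW W x) := Summable.of_nonneg_of_le (hnn x) (hle x) hs2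
    refine ⟨hs3, ?_⟩
    have e := (Equiv.subLeft x).tsum_eq (fun z : Z d => C * latDist z 0 ^ (-(d : ℝ) - 2 * s))
    have h3 := hs3.tsum_le_tsum (hle x) hs2
    simp only [Equiv.subLeft_apply] at e
    linarith

/-- Abstract nonlinearity facts used in the variational argument (`q = p/2`). -/
structure NL (q θ : ℝ) (g G : ℝ → ℝ) : Prop where
  cont : Continuous g
  der : ∀ t, HasDerivAt G (g t) t
  gneg : ∀ t ≤ 0, g t = 0
  Gneg : ∀ t ≤ 0, G t = 0
  gnn : ∀ t, 0 ≤ g t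
  Gnn : ∀ t, 0 ≤ G t
  ar : ∀ t, θ / 2 * G t ≤ g t * t
  small : ∃ δ > 0, ∀ t, |t| < δ → G t ≤ (t ^ 2) ^ q
  bdd : ∀ b, ∃ C, 0 ≤ C ∧ ∀ t, |t| ≤ b → G t ≤ C * (t ^ 2) ^ q ∧ g t * t ≤ C * (t ^ 2) ^ q
  ray : ∀ A κ, 0 ≤ A → 0 < κ → ∃ M, 0 ≤ M ∧ ∀ t, 0 ≤ t → A * (t ^ 2) ^ q - κ * (G t) ^ 2 ≤ M

lemma sq_rpow_half {t : ℝ} (ht : 0 ≤ t) (q : ℝ) : (t ^ 2) ^ q = t ^ (2 * q) := by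
  rw [Real.rpow_mul ht]; norm_num

lemma exists_NL {p θ : ℝ} (hp : 2 ≤ p) {f : ℝ → ℝ} (hfc : Continuous f) (hf0 : f 0 = 0)
    (hf1 : F1 f p) (hθ : p < θ) (hf3 : F3 f θ) (hFpos : ∀ t > (0 : ℝ), 0 < Fint f t) :
    ∃ g G : ℝ → ℝ, NL (p / 2) θ g G ∧ ∀ t, 0 < t → g t = f t ∧ G t = Fint f t := by
  set g : ℝ → ℝ := fun t => f (max t 0) with hg
  set G : ℝ → ℝ := Fint g with hG
  have gc : Continuous g := hfc.comp (continuous_id.max continuous_const)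
  have gpos : ∀ t, 0 < t → g t = f t := fun t ht => by simp [hg, max_eq_left ht.le]
  have gneg : ∀ t ≤ 0, g t = 0 := fun t ht => by simp [hg, max_eq_right ht, hf0]
  have Gpos : ∀ t, 0 < t → G t = Fint f t := by
    intro t ht
    simp only [hG, Fint]
    apply intervalIntegral.integral_congr
    intro x hx
    rw [Set.uIcc_of_le ht.le] at hx
    simp [hg, max_eq_left hx.1]
  have Gneg : ∀ t ≤ 0, G t = 0 := by
    intro t ht
    simp only [hG, Fint]
    rw [intervalIntegral.integral_congr (g := fun _ => (0:ℝ))]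
    · simp
    · intro x hx
      rw [Set.uIcc_of_ge ht] at hx
      exact gneg x hx.2
  have der : ∀ t, HasDerivAt G (g t) t := fun t =>
    intervalIntegral.integral_hasDerivAt_right (gc.intervalIntegrable _ _)
      gc.aestronglyMeasurable.stronglyMeasurableAtFilter gc.continuousAt
  have Gnn : ∀ t, 0 ≤ G t := by
    intro t
    rcases le_or_gt t 0 with h | h
    · rw [Gneg t h]
    · rw [Gpos t h]; exact (hFpos t h).le
  have ar : ∀ t, θ / 2 * G t ≤ g t * t := by
    intro t
    rcases le_or_gt t 0 with h | h
    · rw [Gneg t h, gneg t h]; simp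
    · rw [Gpos t h, gpos t h]; linarith [(hf3 t h).2]
  have gnn : ∀ t, 0 ≤ g t := by
    intro t
    rcases le_or_gt t 0 with h | h
    · rw [gneg t h]
    · by_contra hc
      push Not at hc
      have := ar t
      have h2 := Gnn t
      have : g t * t < 0 := mul_neg_of_neg_of_pos hc h
      have : 0 ≤ θ / 2 * G t := by apply mul_nonneg _ h2; linarith
      linarith
  have Gle : ∀ t, G t ≤ g t * t := by
    intro t
    nlinarith [ar t, Gnn t]
  have h2q : 2 * (p / 2) = p := by ring
  obtain ⟨δ, hδ, hδf⟩ := hf1 1 one_pos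
  have gsm : ∀ t, t < δ → g t * t ≤ (t ^ 2) ^ (p / 2) := by
    intro t ht
    rcases le_or_gt t 0 with h | h
    · rw [gneg t h]; simp; positivity
    · rw [gpos t h, sq_rpow_half h.le, h2q]
      have := hδf t h ht
      have h3 : t ^ p = t ^ (p - 1) * t := by
        rw [← Real.rpow_add_one h.ne']; ring_nf
      rw [h3]
      have := le_abs_self (f t)
      nlinarith
  have hbdd : ∀ b, ∃ C, 0 ≤ C ∧ ∀ t, |t| ≤ b → g t * t ≤ C * (t ^ 2) ^ (p / 2) := by
    intro b
    obtain ⟨K, hK⟩ := (isCompact_Icc (a := -b) (b := b)).exists_bound_of_continuousOn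
      (f := fun t => g t * t) (by fun_prop)
    refine ⟨max 1 (|K| / (δ ^ 2) ^ (p / 2)), le_max_of_le_left zero_le_one, ?_⟩
    intro t ht
    have h0 : 0 ≤ (t ^ 2) ^ (p / 2) := by positivity
    rcases lt_or_ge t δ with h | h
    · calc g t * t ≤ 1 * (t ^ 2) ^ (p / 2) := by rw [one_mul]; exact gsm t h
        _ ≤ _ := by gcongr; exact le_max_left _ _
    · have hd2 : 0 < (δ ^ 2) ^ (p / 2) := by positivity
      have h1 : (δ ^ 2) ^ (p / 2) ≤ (t ^ 2) ^ (p / 2) := by gcongr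
      have h2 := hK t (abs_le.1 ht)
      calc g t * t ≤ |K| := (le_abs_self _).trans (h2.trans (le_abs_self _))
        _ = |K| / (δ ^ 2) ^ (p / 2) * (δ ^ 2) ^ (p / 2) := by field_simp
        _ ≤ |K| / (δ ^ 2) ^ (p / 2) * (t ^ 2) ^ (p / 2) := by gcongr
        _ ≤ _ := by gcongr; exact le_max_right _ _
  have grow : ∀ t, 1 ≤ t → G 1 * t ^ (θ / 2) ≤ G t := by
    have hder : ∀ t, 0 < t → HasDerivAt (fun t => G t * t ^ (-(θ / 2)))
        (g t * t ^ (-(θ / 2)) + G t * (-(θ / 2) * t ^ (-(θ / 2) - 1))) t := fun t ht =>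
      (der t).mul (Real.hasDerivAt_rpow_const (Or.inl ht.ne'))
    have hm : MonotoneOn (fun t => G t * t ^ (-(θ / 2))) (Set.Ici 1) := by
      apply monotoneOn_of_deriv_nonneg (convex_Ici 1)
      · intro t ht
        exact (hder t (lt_of_lt_of_le one_pos ht)).continuousAt.continuousWithinAt
      · intro t ht
        rw [interior_Ici] at ht
        exact (hder t (one_pos.trans ht)).differentiableAt.differentiableWithinAt
      · intro t ht
        rw [interior_Ici] at ht
        have t0 : 0 < t := one_pos.trans ht
        rw [(hder t t0).deriv]
        have e : t ^ (-(θ / 2)) = t ^ (-(θ / 2) - 1) * t := by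
          rw [← Real.rpow_add_one t0.ne']; ring_nf
        rw [e]
        have := ar t
        have h3 : 0 ≤ t ^ (-(θ / 2) - 1) := by positivity
        nlinarith [mul_nonneg h3 (sub_nonneg.2 this)]
    intro t ht
    have t0 : 0 < t := one_pos.trans_le ht
    have h1 := hm (Set.mem_Ici.2 le_rfl) ht ht
    simp only [Real.one_rpow, mul_one] at h1
    calc G 1 * t ^ (θ / 2) ≤ G t * t ^ (-(θ / 2)) * t ^ (θ / 2) := by gcongr
      _ = G t := by rw [mul_assoc, ← Real.rpow_add t0]; simp
  refine ⟨g, G, ⟨gc, der, gneg, Gneg, gnn, Gnn, ar, ⟨δ, hδ, ?_⟩, ?_, ?_⟩, fun t ht => ⟨gpos t ht, Gpos t ht⟩⟩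
  · intro t ht
    exact (Gle t).trans (gsm t ((le_abs_self t).trans_lt ht))
  · intro b
    obtain ⟨C, hC, h⟩ := hbdd b
    exact ⟨C, hC, fun t ht => ⟨(Gle t).trans (h t ht), h t ht⟩⟩
  · intro A κ hA hκ
    have hG1 : 0 < G 1 := by rw [Gpos 1 one_pos]; exact hFpos 1 one_pos
    set κ' := κ * (G 1) ^ 2
    have hκ' : 0 < κ' := by positivity
    have hθp : 0 < θ - p := by linarith
    set T := max 1 ((A / κ') ^ (1 / (θ - p)))
    have hT1 : 1 ≤ T := le_max_left _ _
    have hT0 : 0 < T := one_pos.trans_le hT1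
    refine ⟨A * T ^ p, by positivity, ?_⟩
    intro t ht
    rw [sq_rpow_half ht, h2q]
    rcases le_or_gt t T with h | h
    · have : A * t ^ p ≤ A * T ^ p := by gcongr
      have : 0 ≤ κ * G t ^ 2 := by positivity
      linarith
    · have t1 : 1 ≤ t := hT1.trans h.le
      have t0 : 0 < t := one_pos.trans_le t1
      have h1 : A / κ' ≤ t ^ (θ - p) := by
        have h2 : (A / κ') ^ (1 / (θ - p)) ≤ t := (le_max_right _ _).trans h.le
        calc A / κ' = ((A / κ') ^ (1 / (θ - p))) ^ (θ - p) := by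
              rw [← Real.rpow_mul (by positivity), one_div_mul_cancel hθp.ne', Real.rpow_one]
          _ ≤ _ := by gcongr
      rw [div_le_iff₀ hκ'] at h1
      have h3 : (G 1 * t ^ (θ / 2)) ^ 2 ≤ G t ^ 2 := by
        have := grow t t1
        gcongr
      have h4 : (t ^ (θ / 2)) ^ 2 = t ^ (θ - p) * t ^ p := by
        rw [← Real.rpow_add t0, ← Real.rpow_natCast, ← Real.rpow_mul t0.le]; congr 1; push_cast; ring
      have h5 : A * t ^ p ≤ κ * G t ^ 2 := by
        calc A * t ^ p ≤ t ^ (θ - p) * κ' * t ^ p := by gcongr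
          _ = κ * (G 1 * t ^ (θ / 2)) ^ 2 := by rw [mul_pow, h4]; ring
          _ ≤ _ := by gcongr
      have : 0 ≤ A * T ^ p := by positivity
      linarith

section finite
variable {ι : Type} [Fintype ι]

/-- Finite quadratic form at a site. -/
def fQ (w : ι → ι → ℝ) (u : ι → ℝ) (x : ι) : ℝ := (1 / 2) * ∑ y, w x y * (u x - u y) ^ 2

/-- Finite energy. -/
def fJ (q : ℝ) (w : ι → ι → ℝ) (h : ι → ℝ) (R : ι → ι → ℝ) (G : ℝ → ℝ) (u : ι → ℝ) : ℝ :=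
  1 / (2 * q) * ∑ x, (fQ w u x ^ q + h x * (u x ^ 2) ^ q)
    - 1 / 2 * ∑ x, ∑ y, R x y * (G (u x) * G (u y))

/-- Its directional derivative. -/
def fDJ (q : ℝ) (w : ι → ι → ℝ) (h : ι → ℝ) (R : ι → ι → ℝ) (g G : ℝ → ℝ) (u φ : ι → ℝ) : ℝ :=
  ∑ x, (fQ w u x ^ (q - 1) * (1 / 2 * ∑ y, w x y * ((u x - u y) * (φ x - φ y)))
      + h x * ((u x ^ 2) ^ (q - 1) * (u x * φ x)))
    - ∑ x, (∑ y, R x y * G (u y)) * (g (u x) * φ x)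

lemma fQ_nonneg {w : ι → ι → ℝ} (hw : ∀ x y, 0 ≤ w x y) (u : ι → ℝ) (x : ι) : 0 ≤ fQ w u x := by
  unfold fQ
  have : 0 ≤ ∑ y, w x y * (u x - u y) ^ 2 :=
    Finset.sum_nonneg fun y _ => mul_nonneg (hw x y) (sq_nonneg _)
  linarith

lemma fJ_contDiff {q : ℝ} (hq : 1 ≤ q) (w : ι → ι → ℝ) (h : ι → ℝ) (R : ι → ι → ℝ)
    {g G : ℝ → ℝ} (gc : Continuous g) (der : ∀ t, HasDerivAt G (g t) t) :
    ContDiff ℝ 1 (fun u : EuclideanSpace ℝ ι => fJ q w h R G (fun x => u x)) := by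
  have hc : ∀ x : ι, ContDiff ℝ 1 (fun u : EuclideanSpace ℝ ι => u x) := fun x =>
    (EuclideanSpace.proj (𝕜 := ℝ) x).contDiff
  have hG : ContDiff ℝ 1 G := by
    rw [contDiff_one_iff_deriv]
    refine ⟨fun t => (der t).differentiableAt, ?_⟩
    have : deriv G = g := funext fun t => (der t).deriv
    rw [this]; exact gc
  have hr : ContDiff ℝ 1 (fun t : ℝ => t ^ q) := by
    have := Real.contDiff_rpow_const_of_le (p := q) (n := 1) (by simpa using hq)
    simpa using this
  unfold fJ fQ
  have h1 : ∀ x : ι, ContDiff ℝ 1 (fun u : EuclideanSpace ℝ ι =>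
      (1 / 2) * ∑ y, w x y * (u x - u y) ^ 2) := by
    intro x
    refine contDiff_const.mul (ContDiff.sum fun y _ => contDiff_const.mul (((hc x).sub (hc y)).pow 2))
  refine (contDiff_const.mul (ContDiff.sum fun x _ => ?_)).sub
    (contDiff_const.mul (ContDiff.sum fun x _ => ContDiff.sum fun y _ => contDiff_const.mul
      ((hG.comp (hc x)).mul (hG.comp (hc y)))))
  exact (hr.comp (h1 x)).add (contDiff_const.mul (hr.comp ((hc x).pow 2)))

lemma fJ_hasDerivAt {q : ℝ} (hq : 1 ≤ q) (w : ι → ι → ℝ) (h : ι → ℝ) {R : ι → ι → ℝ}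
    (hR : ∀ x y, R x y = R y x)
    {g G : ℝ → ℝ} (der : ∀ t, HasDerivAt G (g t) t) (u φ : ι → ℝ) :
    HasDerivAt (fun t : ℝ => fJ q w h R G (fun x => u x + t * φ x)) (fDJ q w h R g G u φ) 0 := by
  have hl : ∀ x, HasDerivAt (fun t : ℝ => u x + t * φ x) (φ x) 0 := by
    intro x
    simpa using ((hasDerivAt_id (0:ℝ)).mul_const (φ x)).const_add (u x)
  have hQ : ∀ x, HasDerivAt (fun t : ℝ => fQ w (fun x => u x + t * φ x) x)
      (∑ y, w x y * ((u x - u y) * (φ x - φ y))) 0 := by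
    intro x
    have := (HasDerivAt.fun_sum (u := Finset.univ) (fun y _ =>
      (((hl x).fun_sub (hl y)).fun_pow 2).const_mul (w x y))).const_mul (1/2 : ℝ)
    refine this.congr_deriv ?_
    rw [Finset.mul_sum]
    apply Finset.sum_congr rfl
    intro y _
    simp; ring
  have hQ0 : ∀ x, fQ w (fun x => u x + 0 * φ x) x = fQ w u x := by intro x; simp
  have hGl : ∀ x, HasDerivAt (fun t : ℝ => G (u x + t * φ x)) (g (u x) * φ x) 0 := by
    intro x
    have h1 : HasDerivAt G (g (u x)) (u x + 0 * φ x) := by simpa using der (u x)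
    exact h1.comp 0 (hl x)
  have h1 := (HasDerivAt.fun_sum (u := Finset.univ) (fun x _ =>
    ((hQ x).rpow_const (p := q) (Or.inr hq)).fun_add
      ((((hl x).fun_pow 2).rpow_const (p := q) (Or.inr hq)).const_mul (h x)))).const_mul (1 / (2 * q))
  have h2 := (HasDerivAt.fun_sum (u := Finset.univ) (fun x _ =>
    HasDerivAt.fun_sum (u := Finset.univ) (fun y _ =>
    ((hGl x).fun_mul (hGl y)).const_mul (R x y)))).const_mul (1 / 2 : ℝ)
  refine (h1.fun_sub h2).congr_deriv ?_
  simp only [hQ0, zero_mul, add_zero]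
  unfold fDJ
  congr 1
  · rw [Finset.mul_sum]
    apply Finset.sum_congr rfl
    intro x _
    have : q ≠ 0 := by positivity
    simp only [Nat.cast_ofNat, Nat.add_one_sub_one, pow_one]
    field_simp
  · have e : ∑ x, ∑ y, R x y * (G (u x) * (g (u y) * φ y))
        = ∑ x, ∑ y, R x y * (g (u x) * φ x * G (u y)) := by
      rw [Finset.sum_comm]
      refine Finset.sum_congr rfl fun x _ => Finset.sum_congr rfl fun y _ => ?_
      rw [hR y x]; ring
    simp only [mul_add, Finset.sum_add_distrib]
    rw [e, ← add_mul, ← two_mul] <;> try ring_nf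
    simp only [Finset.sum_mul]
    refine Finset.sum_congr rfl fun x _ => Finset.sum_congr rfl fun y _ => ?_
    ring

lemma fJ_fderiv {q : ℝ} (hq : 1 ≤ q) (w : ι → ι → ℝ) (h : ι → ℝ) {R : ι → ι → ℝ}
    (hR : ∀ x y, R x y = R y x)
    {g G : ℝ → ℝ} (gc : Continuous g) (der : ∀ t, HasDerivAt G (g t) t)
    (u φ : EuclideanSpace ℝ ι) :
    fderiv ℝ (fun u : EuclideanSpace ℝ ι => fJ q w h R G (fun x => u x)) u φ
      = fDJ q w h R g G (fun x => u x) (fun x => φ x) := by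
  have h1 := (((fJ_contDiff hq w h R gc der).differentiable one_ne_zero) u).hasFDerivAt
  have hl : HasDerivAt (fun t : ℝ => u + t • φ) φ 0 := by
    simpa using ((hasDerivAt_id (0:ℝ)).smul_const φ).const_add u
  have h1' : HasFDerivAt (fun u : EuclideanSpace ℝ ι => fJ q w h R G (fun x => u x))
    (fderiv ℝ (fun u : EuclideanSpace ℝ ι => fJ q w h R G (fun x => u x)) u) (u + (0:ℝ) • φ) := by
    simpa using h1
  have h2 := h1'.comp_hasDerivAt 0 hl
  have h3 := fJ_hasDerivAt hq w h hR der (fun x => u x) (fun x => φ x)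
  refine h2.unique (h3.congr_of_eventuallyEq ?_)
  filter_upwards with t
  simp

lemma fDJ_self {q : ℝ} (hq : 1 ≤ q) {w : ι → ι → ℝ} (hw : ∀ x y, 0 ≤ w x y) (h : ι → ℝ) (R : ι → ι → ℝ)
    (g G : ℝ → ℝ) (u : ι → ℝ) :
    fDJ q w h R g G u u = ∑ x, (fQ w u x ^ q + h x * (u x ^ 2) ^ q)
      - ∑ x, (∑ y, R x y * G (u y)) * (g (u x) * u x) := by
  unfold fDJ
  congr 1
  refine Finset.sum_congr rfl fun x _ => ?_
  have e : ∀ t : ℝ, 0 ≤ t → t ^ q = t ^ (q - 1) * t := by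
    intro t ht
    rw [← Real.rpow_add_one' ht (by linarith)]; ring_nf
  rw [e _ (fQ_nonneg hw u x), e _ (sq_nonneg (u x))]
  congr 2
  · unfold fQ
    congr 1
    exact Finset.sum_congr rfl fun y _ => by ring
  · ring

lemma fDJ_single [DecidableEq ι] {q : ℝ} {w : ι → ι → ℝ} (hws : ∀ x y, w x y = w y x) (h : ι → ℝ)
    (R : ι → ι → ℝ) (g G : ℝ → ℝ) (u : ι → ℝ) (z : ι) :
    fDJ q w h R g G u (fun x => if x = z then 1 else 0) =
      1 / 2 * ∑ y, w z y * (fQ w u z ^ (q - 1) + fQ w u y ^ (q - 1)) * (u z - u y)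
      + h z * ((u z ^ 2) ^ (q - 1) * u z) - (∑ y, R z y * G (u y)) * g (u z) := by
  unfold fDJ
  rw [Finset.sum_add_distrib]
  congr 1
  · congr 1
    · have key : ∀ x, fQ w u x ^ (q - 1) * (1 / 2 * ∑ y, w x y * ((u x - u y) *
          ((if x = z then (1:ℝ) else 0) - if y = z then 1 else 0)))
          = (if x = z then 1 / 2 * ∑ y, w z y * fQ w u z ^ (q - 1) * (u z - u y) else 0)
            + 1 / 2 * (w z x * fQ w u x ^ (q - 1) * (u z - u x)) := by
        intro x
        have e1 : ∑ y, w x y * ((u x - u y) * ((if x = z then (1:ℝ) else 0) - if y = z then 1 else 0))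
          = (if x = z then ∑ y, w x y * (u x - u y) else 0) - w x z * (u x - u z) := by
          simp only [mul_sub, Finset.sum_sub_distrib]
          split_ifs <;> simp [mul_sub, Finset.sum_sub_distrib]
        rw [e1, hws z x]
        split_ifs with hx
        · subst hx
          have : ∑ y, w x y * fQ w u x ^ (q - 1) * (u x - u y)
            = fQ w u x ^ (q - 1) * ∑ y, w x y * (u x - u y) := by
            rw [Finset.mul_sum]; exact Finset.sum_congr rfl fun y _ => by ring
          rw [this]; ring
        · ring
      rw [Finset.sum_congr rfl fun x _ => key x, Finset.sum_add_distrib, Finset.sum_ite_eq',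
        if_pos (Finset.mem_univ _), ← Finset.mul_sum, ← mul_add, ← Finset.sum_add_distrib]
      congr 1
      exact Finset.sum_congr rfl fun y _ => by ring
    · simp
  · simp
end finite

section finite2

/-- Uniform finite-dimensional existence. -/
lemma finite_exists {q θ : ℝ} (hq : 1 ≤ q) (hθ : 2 * q < θ) {g G : ℝ → ℝ} (hNL : NL q θ g G)
    {h₀ R₀ S H : ℝ} (hh₀ : 0 < h₀) (hR₀ : 0 < R₀) (hS : 0 < S) (hH : 0 < H) :
    ∃ c M : ℝ, 0 < c ∧ 0 < M ∧ ∀ (ι : Type) [Fintype ι] [DecidableEq ι] (o : ι) (w R : ι → ι → ℝ)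
      (h : ι → ℝ), (∀ x y, w x y = w y x) → (∀ x y, 0 ≤ w x y) → (∀ x, ∑ y, w x y ≤ S) →
      (∀ x y, R x y = R y x) → (∀ x y, 0 ≤ R x y) → (∀ x y, R x y ≤ R₀) → R o o = R₀ →
      (∀ x, h₀ ≤ h x) → h o = H →
      ∃ u : ι → ℝ, (∀ z, 1 / 2 * ∑ y, w z y * (fQ w u z ^ (q - 1) + fQ w u y ^ (q - 1)) * (u z - u y)
          + h z * ((u z ^ 2) ^ (q - 1) * u z) = (∑ y, R z y * G (u y)) * g (u z)) ∧
        ∑ x, (fQ w u x ^ q + h x * (u x ^ 2) ^ q) ≤ M ∧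
        c ≤ ∑ x, (fQ w u x ^ q + h x * (u x ^ 2) ^ q) ∧
        ∑ x, (fQ w u x ^ q + h x * (u x ^ 2) ^ q) = ∑ x, (∑ y, R x y * G (u y)) * (g (u x) * u x) := by
  have q0 : 0 < q := by linarith
  obtain ⟨δ, hδ, hsm⟩ := hNL.small
  obtain ⟨M, hM, hray⟩ := hNL.ray (1 / (2 * q) * (S ^ (q - 1) * S + H)) (1 / 2 * R₀)
    (by positivity) (by positivity)
  set r := min (h₀ ^ 2 / (2 * q * R₀)) (h₀ * (δ ^ 2) ^ q / 2) with hr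
  have r0 : 0 < r := by rw [hr]; positivity
  have hr1 : r ≤ h₀ ^ 2 / (2 * q * R₀) := min_le_left _ _
  have hr2 : r < h₀ * (δ ^ 2) ^ q := by
    have : r ≤ h₀ * (δ ^ 2) ^ q / 2 := min_le_right _ _
    have h2 : 0 < h₀ * (δ ^ 2) ^ q := by positivity
    linarith
  have hκ : 0 < 1 / (2 * q) - 1 / θ := by
    have := one_div_lt_one_div_of_lt (by positivity : 0 < 2 * q) hθ
    linarith
  set κ := 1 / (2 * q) - 1 / θ with hκdef
  set M' := (M + 1) / κ with hM'
  have M'0 : 0 < M' := by rw [hM']; positivity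
  have θ0 : 0 < θ := by linarith
  refine ⟨q * (r / (4 * q)), M', by positivity, M'0, ?_⟩
  intro ι _ _ o w R h hws hwn hwS hRs hRn hRle hRo hh hho
  have hhn : ∀ x, 0 ≤ h x := fun x => hh₀.le.trans (hh x)
  have hQn := fun (u : ι → ℝ) x => fQ_nonneg hwn u x
  have hterm : ∀ (u : ι → ℝ) x, 0 ≤ h x * (u x ^ 2) ^ q := fun u x =>
    mul_nonneg (hhn x) (by positivity)
  have hNP : ∀ u : ι → ℝ, ∑ x, h x * (u x ^ 2) ^ q ≤ ∑ x, (fQ w u x ^ q + h x * (u x ^ 2) ^ q) := by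
    intro u
    refine Finset.sum_le_sum fun x _ => ?_
    have := Real.rpow_nonneg (hQn u x) q
    linarith
  have hcoord : ∀ (u : ι → ℝ) x, h₀ * (u x ^ 2) ^ q ≤ ∑ x, h x * (u x ^ 2) ^ q := by
    intro u x
    calc h₀ * (u x ^ 2) ^ q ≤ h x * (u x ^ 2) ^ q := by have := hh x; gcongr
      _ ≤ _ := Finset.single_le_sum (f := fun x => h x * (u x ^ 2) ^ q) (fun y _ => hterm u y)
        (Finset.mem_univ x)
  -- the Ambrosetti-Rabinowitz inequality
  have hARineq : ∀ u : ι → ℝ, κ * ∑ x, (fQ w u x ^ q + h x * (u x ^ 2) ^ q) ≤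
      fJ q w h R G u - 1 / θ * fDJ q w h R g G u u := by
    intro u
    rw [fDJ_self hq hwn]
    unfold fJ
    have h1 : θ / 2 * ∑ x, ∑ y, R x y * (G (u x) * G (u y)) ≤
        ∑ x, (∑ y, R x y * G (u y)) * (g (u x) * u x) := by
      rw [Finset.mul_sum]
      refine Finset.sum_le_sum fun x _ => ?_
      rw [Finset.mul_sum, Finset.sum_mul]
      refine Finset.sum_le_sum fun y _ => ?_
      have := hNL.ar (u x)
      have h2 : 0 ≤ R x y * G (u y) := mul_nonneg (hRn x y) (hNL.Gnn _)
      nlinarith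
    have h2 : 1 / 2 * ∑ x, ∑ y, R x y * (G (u x) * G (u y)) ≤
        1 / θ * ∑ x, (∑ y, R x y * G (u y)) * (g (u x) * u x) := by
      calc _ = 1 / θ * (θ / 2 * ∑ x, ∑ y, R x y * (G (u x) * G (u y))) := by field_simp
        _ ≤ _ := by gcongr
    rw [hκdef]
    nlinarith
  set B := max M' r with hB
  have B0 : 0 ≤ B := r0.le.trans (le_max_right _ _)
  set Rad : ℝ := 1 + Fintype.card ι * (B / h₀) ^ (1 / q) with hRad
  have hRad1 : 1 ≤ Rad := by rw [hRad]; have : 0 ≤ Fintype.card ι * (B / h₀) ^ (1 / q) := by positivity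
                             linarith
  have hcoer : ∀ u : EuclideanSpace ℝ ι, Rad ≤ ‖u‖ → B < ∑ x, h x * (u x ^ 2) ^ q := by
    intro u hu
    by_contra hc
    push Not at hc
    have h1 : ∀ x, u x ^ 2 ≤ (B / h₀) ^ (1 / q) := by
      intro x
      have h2 := (hcoord (fun x => u x) x).trans hc
      have h3 : (u x ^ 2) ^ q ≤ B / h₀ := by rw [le_div_iff₀ hh₀]; linarith
      calc u x ^ 2 = ((u x ^ 2) ^ q) ^ (1 / q) := by
            rw [← Real.rpow_mul (sq_nonneg _), mul_one_div_cancel q0.ne', Real.rpow_one]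
        _ ≤ _ := by gcongr
    have h2 : ‖u‖ ^ 2 ≤ Fintype.card ι * (B / h₀) ^ (1 / q) := by
      rw [EuclideanSpace.norm_sq_eq]
      calc ∑ x, ‖u x‖ ^ 2 ≤ ∑ x : ι, (B / h₀) ^ (1 / q) := by
            refine Finset.sum_le_sum fun x _ => ?_
            rw [Real.norm_eq_abs, sq_abs]; exact h1 x
        _ = _ := by simp
    nlinarith
  have key := mountain_pass (E := EuclideanSpace ℝ ι) (fun u => fJ q w h R G (fun x => u x))
    (fJ_contDiff hq w h R hNL.cont hNL.der) (fun u => ∑ x, h x * (u x ^ 2) ^ q)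
    (by
      refine continuous_finset_sum _ fun x _ => continuous_const.mul ?_
      refine Continuous.rpow_const ?_ (fun _ => Or.inr q0.le)
      exact ((EuclideanSpace.proj (𝕜 := ℝ) x).continuous).pow 2)
    (a := r / (4 * q)) (M := M) (r := r) (R := Rad) (by positivity)
    (by simp [fJ, fQ, hNL.Gneg 0 le_rfl, Real.zero_rpow q0.ne'])
    (by simpa [Real.zero_rpow q0.ne'] using r0)
    (by
      intro u hu
      have hGle : ∀ x, h₀ * G (u x) ≤ h x * (u x ^ 2) ^ q := by
        intro x
        have h1 := hcoord (fun x => u x) x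
        simp only at hu h1
        rw [hu] at h1
        have h2 : (u x ^ 2) ^ q < (δ ^ 2) ^ q := by
          have := h1.trans_lt hr2
          exact lt_of_mul_lt_mul_left this hh₀.le
        have h3 : u x ^ 2 < δ ^ 2 := (Real.rpow_lt_rpow_iff (sq_nonneg _) (sq_nonneg _) q0).1 h2
        have h4 : |u x| < δ := abs_lt_of_sq_lt_sq h3 hδ.le
        calc h₀ * G (u x) ≤ h₀ * (u x ^ 2) ^ q := by have := hsm _ h4; gcongr
          _ ≤ _ := by have := hh x; gcongr
      have hsum : h₀ * ∑ x, G (u x) ≤ r := by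
        rw [Finset.mul_sum, ← hu]
        exact Finset.sum_le_sum fun x _ => hGle x
      have hSn : 0 ≤ ∑ x, G (u x) := Finset.sum_nonneg fun x _ => hNL.Gnn _
      have hd : ∑ x, ∑ y, R x y * (G (u x) * G (u y)) ≤ R₀ * (∑ x, G (u x)) ^ 2 := by
        rw [sq, Finset.sum_mul_sum, Finset.mul_sum]
        refine Finset.sum_le_sum fun x _ => ?_
        rw [Finset.mul_sum]
        refine Finset.sum_le_sum fun y _ => ?_
        exact mul_le_mul_of_nonneg_right (hRle x y) (mul_nonneg (hNL.Gnn _) (hNL.Gnn _))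
      have h5 : ∑ x, G (u x) ≤ r / h₀ := by rw [le_div_iff₀ hh₀]; linarith
      have h6 : R₀ * (∑ x, G (u x)) ^ 2 ≤ r / (2 * q) := by
        calc R₀ * (∑ x, G (u x)) ^ 2 ≤ R₀ * (r / h₀) ^ 2 := by gcongr
          _ = R₀ / h₀ ^ 2 * r * r := by field_simp
          _ ≤ R₀ / h₀ ^ 2 * (h₀ ^ 2 / (2 * q * R₀)) * r := by gcongr
          _ = _ := by field_simp
      have h7 := hNP (fun x => u x)
      simp only at hu h7
      rw [hu] at h7
      unfold fJ
      have h8 : 1 / (2 * q) * r ≤ 1 / (2 * q) *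
          ∑ x, (fQ w (fun x => u x) x ^ q + h x * (u x ^ 2) ^ q) := by gcongr
      have h9 : r / (4 * q) = 1 / (2 * q) * r - 1 / 2 * (r / (2 * q)) := by field_simp; ring
      rw [h9]
      linarith)
    (fun u hu => (le_max_right _ _).trans_lt (hcoer u hu))
    (by
      intro u hu hJ
      rw [fJ_fderiv hq w h hRs hNL.cont hNL.der]
      by_contra hc
      push Not at hc
      have h1 := hARineq (fun x => u x)
      have h2 := (le_max_left M' r).trans_lt ((hcoer u hu).trans_le (hNP (fun x => u x)))
      have h3 : M + 1 < κ * ∑ x, (fQ w (fun x => u x) x ^ q + h x * (u x ^ 2) ^ q) := by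
        rw [hM', div_lt_iff₀ hκ] at h2
        linarith
      have : 0 ≤ 1 / θ * fDJ q w h R g G (fun x => u x) (fun x => u x) := by positivity
      linarith)
    (EuclideanSpace.single o 1) (by simp)
    (by
      intro t ht
      set e : ι → ℝ := fun x => if x = o then 1 else 0 with he
      have hte : (fun x => (t • EuclideanSpace.single o (1:ℝ)) x) = fun x => t * e x := by
        funext x; simp [he, Pi.single_apply]
      rw [hte]
      have hQt : ∀ x, fQ w (fun x => t * e x) x = t ^ 2 * fQ w e x := by
        intro x
        unfold fQ
        rw [Finset.mul_sum, Finset.mul_sum, Finset.mul_sum]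
        exact Finset.sum_congr rfl fun y _ => by ring
      have hQe : ∀ x, fQ w e x ≤ 1 / 2 * (S * e x + w x o) := by
        intro x
        unfold fQ
        gcongr
        calc ∑ y, w x y * (e x - e y) ^ 2 ≤ ∑ y, (w x y * e x + w x y * e y) := by
              refine Finset.sum_le_sum fun y _ => ?_
              rw [← mul_add]
              have := hwn x y
              gcongr
              simp only [he]; split_ifs <;> norm_num
          _ = (∑ y, w x y) * e x + w x o := by
              rw [Finset.sum_add_distrib, Finset.sum_mul]; simp [he]
          _ ≤ _ := by
              have : 0 ≤ e x := by simp only [he]; split_ifs <;> norm_num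
              have := hwS x
              gcongr
      have hwle : ∀ x, w x o ≤ S := fun x =>
        (Finset.single_le_sum (f := fun y => w x y) (fun y _ => hwn x y) (Finset.mem_univ o)).trans (hwS x)
      have hQS : ∀ x, fQ w e x ≤ S := by
        intro x
        have h1 := hQe x
        have h2 : e x ≤ 1 := by simp only [he]; split_ifs <;> norm_num
        nlinarith [hwle x]
      have hsumQ : ∑ x, fQ w e x ^ q ≤ S ^ (q - 1) * S := by
        calc ∑ x, fQ w e x ^ q ≤ ∑ x, S ^ (q - 1) * (1 / 2 * (S * e x + w x o)) := by
              refine Finset.sum_le_sum fun x _ => ?_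
              have e1 : fQ w e x ^ q = fQ w e x ^ (q - 1) * fQ w e x := by
                rw [← Real.rpow_add_one' (hQn e x) (by linarith)]; ring_nf
              rw [e1]
              have h0 := hQn e x
              have h1 := hQS x
              have h2 := hQe x
              have h3 : 0 ≤ q - 1 := by linarith
              gcongr
          _ = S ^ (q - 1) * (1 / 2 * (S + ∑ x, w o x)) := by
              rw [← Finset.mul_sum, ← Finset.mul_sum, Finset.sum_add_distrib]
              congr 3
              · simp [he]
              · exact Finset.sum_congr rfl fun x _ => hws x o
          _ ≤ _ := by
              have := hwS o
              have : 1 / 2 * (S + ∑ x, w o x) ≤ S := by linarith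
              gcongr
      refine le_trans ?_ (hray t ht)
      unfold fJ
      have h1 : ∑ x, (fQ w (fun x => t * e x) x ^ q + h x * ((t * e x) ^ 2) ^ q) ≤
          (S ^ (q - 1) * S + H) * (t ^ 2) ^ q := by
        rw [Finset.sum_add_distrib]
        have a1 : ∑ x, fQ w (fun x => t * e x) x ^ q = (t ^ 2) ^ q * ∑ x, fQ w e x ^ q := by
          rw [Finset.mul_sum]
          refine Finset.sum_congr rfl fun x _ => ?_
          rw [hQt, Real.mul_rpow (sq_nonneg t) (hQn e x)]
        have a2 : ∑ x, h x * ((t * e x) ^ 2) ^ q = H * (t ^ 2) ^ q := by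
          rw [Finset.sum_eq_single o]
          · simp [he, hho]
          · intro x _ hx
            simp [he, hx, Real.zero_rpow q0.ne']
          · simp
        rw [a1, a2]
        have : (t ^ 2) ^ q * ∑ x, fQ w e x ^ q ≤ (t ^ 2) ^ q * (S ^ (q - 1) * S) := by gcongr
        linarith
      have h2 : R₀ * G t ^ 2 ≤ ∑ x, ∑ y, R x y * (G (t * e x) * G (t * e y)) := by
        have hnn : ∀ x y, 0 ≤ R x y * (G (t * e x) * G (t * e y)) := fun x y =>
          mul_nonneg (hRn x y) (mul_nonneg (hNL.Gnn _) (hNL.Gnn _))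
        calc R₀ * G t ^ 2 = R o o * (G (t * e o) * G (t * e o)) := by simp [he, hRo, sq]
          _ ≤ ∑ y, R o y * (G (t * e o) * G (t * e y)) :=
            Finset.single_le_sum (f := fun y => R o y * (G (t * e o) * G (t * e y)))
              (fun y _ => hnn o y) (Finset.mem_univ o)
          _ ≤ _ := Finset.single_le_sum (f := fun x => ∑ y, R x y * (G (t * e x) * G (t * e y)))
              (fun x _ => Finset.sum_nonneg fun y _ => hnn x y) (Finset.mem_univ o)
      have h3 : 1 / (2 * q) * ∑ x, (fQ w (fun x => t * e x) x ^ q + h x * ((t * e x) ^ 2) ^ q) ≤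
          1 / (2 * q) * ((S ^ (q - 1) * S + H) * (t ^ 2) ^ q) := by gcongr
      linarith)
  obtain ⟨u, hu, hJa, hJM⟩ := key
  have hD : ∀ φ : EuclideanSpace ℝ ι, fDJ q w h R g G (fun x => u x) (fun x => φ x) = 0 := by
    intro φ
    rw [← fJ_fderiv hq w h hRs hNL.cont hNL.der, hu]; rfl
  have hDu := hD u
  have hAR := hARineq (fun x => u x)
  rw [hDu] at hAR
  refine ⟨fun x => u x, ?_, ?_, ?_, ?_⟩
  · intro z
    have h1 := hD (EuclideanSpace.single z 1)
    have h2 : (fun x => (EuclideanSpace.single z (1:ℝ)) x) = fun x => if x = z then (1:ℝ) else 0 := by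
      funext x; simp [Pi.single_apply]
    rw [h2, fDJ_single hws] at h1
    linarith
  · rw [hM', le_div_iff₀ hκ]
    linarith
  · have h1 : 0 ≤ ∑ x, ∑ y, R x y * (G (u x) * G (u y)) :=
      Finset.sum_nonneg fun x _ => Finset.sum_nonneg fun y _ =>
        mul_nonneg (hRn x y) (mul_nonneg (hNL.Gnn _) (hNL.Gnn _))
    unfold fJ at hJa
    have h2 : r / (4 * q) / 2 ≤ 1 / (2 * q) * ∑ x, (fQ w (fun x => u x) x ^ q + h x * (u x ^ 2) ^ q) := by
      linarith
    have h3 : q * (r / (4 * q)) = 2 * q * (r / (4 * q) / 2) := by ring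
    rw [h3]
    calc 2 * q * (r / (4 * q) / 2) ≤ 2 * q * (1 / (2 * q) * ∑ x, (fQ w (fun x => u x) x ^ q + h x * (u x ^ 2) ^ q)) := by
          gcongr
      _ = _ := by field_simp
  · rw [fDJ_self hq hwn] at hDu
    linarith
end finite2

section limit
variable {X : Type}

/-- Partial quadratic form. -/
def pQ (w : X → X → ℝ) (Λ : Finset X) (u : X → ℝ) (x : X) : ℝ :=
  (1 / 2) * ∑ y ∈ Λ, w x y * (u x - u y) ^ 2

/-- Full quadratic form. -/
def tQ (w : X → X → ℝ) (u : X → ℝ) (x : X) : ℝ := (1 / 2) * ∑' y, w x y * (u x - u y) ^ 2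

lemma sum_tendsto {l : Filter (Finset X)} (hl : l ≤ atTop) {F : Finset X → X → ℝ} {F' : X → ℝ}
    {bound : X → ℝ} (hb : Summable bound) (hF : ∀ y, Tendsto (fun Λ => F Λ y) l (𝓝 (F' y)))
    (hle : ∀ᶠ Λ in l, ∀ y, |F Λ y| ≤ bound y) :
    Tendsto (fun Λ => ∑ y ∈ Λ, F Λ y) l (𝓝 (∑' y, F' y)) := by
  classical
  have e : (fun Λ : Finset X => ∑ y ∈ Λ, F Λ y) = fun Λ => ∑' y, if y ∈ Λ then F Λ y else 0 := by
    funext Λ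
    rw [tsum_eq_sum (s := Λ) (by intro y hy; simp [hy])]
    exact Finset.sum_congr rfl fun y hy => by simp [hy]
  rw [e]
  refine tendsto_tsum_of_dominated_convergence hb (fun y => ?_) ?_
  · refine (hF y).congr' ?_
    have : ∀ᶠ Λ : Finset X in atTop, y ∈ Λ := by
      filter_upwards [eventually_ge_atTop {y}] with Λ hΛ
      exact hΛ (Finset.mem_singleton_self y)
    filter_upwards [hl this] with Λ hΛ
    simp [hΛ]
  · filter_upwards [hle] with Λ hΛ y
    split_ifs
    · exact hΛ y
    · simpa using (abs_nonneg _).trans (hΛ y)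

lemma tight_tendsto {l : Filter (Finset X)} [l.NeBot] (hl : l ≤ atTop) {a v : Finset X → X → ℝ}
    {a' h : X → ℝ} {K M h₀ : ℝ} (hh₀ : 0 < h₀) (hh : ∀ x, h₀ ≤ h x) (hh2 : Tendsto h cofinite atTop)
    (hK : 0 ≤ K) (hM : 0 < M)
    (ha : ∀ y, Tendsto (fun Λ => a Λ y) l (𝓝 (a' y)))
    (ha0 : ∀ᶠ Λ in l, ∀ y, 0 ≤ a Λ y) (hav : ∀ᶠ Λ in l, ∀ y, a Λ y ≤ K * v Λ y)
    (hv0 : ∀ᶠ Λ in l, ∀ y, 0 ≤ v Λ y)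
    (hv : ∀ᶠ Λ in l, ∑ y ∈ Λ, h y * v Λ y ≤ M) :
    Summable a' ∧ Tendsto (fun Λ => ∑ y ∈ Λ, a Λ y) l (𝓝 (∑' y, a' y)) := by
  classical
  have hge : ∀ T : Finset X, ∀ᶠ Λ in l, T ⊆ Λ := fun T => hl (eventually_ge_atTop T)
  have hT : ∀ T : Finset X, Tendsto (fun Λ => ∑ y ∈ T, a Λ y) l (𝓝 (∑ y ∈ T, a' y)) := fun T =>
    tendsto_finset_sum _ fun y _ => ha y
  have ha'0 : ∀ y, 0 ≤ a' y := fun y => ge_of_tendsto (ha y) (by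
    filter_upwards [ha0] with Λ h; exact h y)
  -- sums over sets where `h` is large
  have hpart : ∀ H > 0, ∀ᶠ Λ in l, ∀ T : Finset X, T ⊆ Λ → (∀ y ∈ T, H ≤ h y) →
      ∑ y ∈ T, a Λ y ≤ K * M / H := by
    intro H hH
    filter_upwards [hav, hv0, hv] with Λ h1 h2 h3 T hTΛ hTH
    rw [le_div_iff₀ hH, Finset.sum_mul]
    calc ∑ y ∈ T, a Λ y * H ≤ ∑ y ∈ T, K * (h y * v Λ y) := by
          refine Finset.sum_le_sum fun y hy => ?_
          calc a Λ y * H ≤ K * v Λ y * H := by have := h1 y; gcongr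
            _ = K * (H * v Λ y) := by ring
            _ ≤ _ := by have := h2 y; have := hTH y hy; gcongr
      _ ≤ ∑ y ∈ Λ, K * (h y * v Λ y) := by
          refine Finset.sum_le_sum_of_subset_of_nonneg hTΛ fun y _ _ => ?_
          exact mul_nonneg hK (mul_nonneg (hh₀.le.trans (hh y)) (h2 y))
      _ ≤ K * M := by rw [← Finset.mul_sum]; gcongr
  have hsum : Summable a' := by
    refine summable_of_sum_le (c := K * M / h₀) ha'0 fun T => ?_
    refine le_of_tendsto (hT T) ?_
    filter_upwards [hpart h₀ hh₀, hge T] with Λ h1 h2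
    exact h1 T h2 fun y _ => hh y
  refine ⟨hsum, ?_⟩
  rw [Metric.tendsto_nhds]
  intro ε hε
  set H := 4 * (K * M + 1) / ε with hH
  have KM : 0 ≤ K * M := by positivity
  have H0 : 0 < H := by rw [hH]; positivity
  have hfin : {x | ¬ H ≤ h x}.Finite := hh2.eventually (eventually_ge_atTop H)
  have hs := (Metric.tendsto_nhds.1 hsum.hasSum) (ε / 4) (by positivity)
  obtain ⟨T, hT1, hT2⟩ := (hs.and (eventually_ge_atTop hfin.toFinset)).exists
  have hTt := (Metric.tendsto_nhds.1 (hT T)) (ε / 4) (by positivity)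
  filter_upwards [hTt, hge T, hpart H H0, ha0] with Λ h1 h2 h3 h4
  have h5 : ∑ y ∈ Λ \ T, a Λ y ≤ K * M / H := by
    refine h3 _ Finset.sdiff_subset fun y hy => ?_
    by_contra hc
    have : y ∈ T := hT2 (by simpa using hc)
    exact (Finset.mem_sdiff.1 hy).2 this
  have h6 : K * M / H ≤ ε / 4 := by
    rw [hH, div_div_eq_mul_div, div_le_iff₀ (by positivity)]
    nlinarith
  have h7 : 0 ≤ ∑ y ∈ Λ \ T, a Λ y := Finset.sum_nonneg fun y _ => h4 y
  have h8 := Finset.sum_sdiff (f := a Λ) h2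
  rw [Real.dist_eq, abs_lt] at *
  constructor <;> linarith

lemma finite_on_finset [DecidableEq X] (o : X) {q θ : ℝ} (hq : 1 ≤ q) (hθ : 2 * q < θ) {g G : ℝ → ℝ}
    (hNL : NL q θ g G)
    {w R : X → X → ℝ} {h : X → ℝ} {h₀ R₀ S : ℝ} (hh₀ : 0 < h₀) (hR₀ : 0 < R₀) (hS : 0 < S)
    (hws : ∀ x y, w x y = w y x) (hwn : ∀ x y, 0 ≤ w x y) (hwS : ∀ x, Summable (w x) ∧ ∑' y, w x y ≤ S)
    (hRs : ∀ x y, R x y = R y x) (hRn : ∀ x y, 0 ≤ R x y) (hRle : ∀ x y, R x y ≤ R₀)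
    (hRo : R o o = R₀) (hh : ∀ x, h₀ ≤ h x) :
    ∃ c M : ℝ, 0 < c ∧ 0 < M ∧ ∀ Λ : Finset X, ∃ u : X → ℝ, o ∈ Λ → (∀ x, x ∉ Λ → u x = 0) ∧
      (∀ z ∈ Λ, 1 / 2 * ∑ y ∈ Λ, w z y * (pQ w Λ u z ^ (q - 1) + pQ w Λ u y ^ (q - 1)) * (u z - u y)
          + h z * ((u z ^ 2) ^ (q - 1) * u z) = (∑ y ∈ Λ, R z y * G (u y)) * g (u z)) ∧
        ∑ x ∈ Λ, (pQ w Λ u x ^ q + h x * (u x ^ 2) ^ q) ≤ M ∧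
        c ≤ ∑ x ∈ Λ, (pQ w Λ u x ^ q + h x * (u x ^ 2) ^ q) ∧
        ∑ x ∈ Λ, (pQ w Λ u x ^ q + h x * (u x ^ 2) ^ q) =
          ∑ x ∈ Λ, (∑ y ∈ Λ, R x y * G (u y)) * (g (u x) * u x) := by
  obtain ⟨c, M, hc, hM, key⟩ := finite_exists hq hθ hNL hh₀ hR₀ hS (hh₀.trans_le (hh o))
  refine ⟨c, M, hc, hM, fun Λ => ?_⟩
  by_cases ho : o ∈ Λ
  swap
  · exact ⟨0, fun h => absurd h ho⟩
  obtain ⟨u, h1, h2, h3, h4⟩ := key Λ ⟨o, ho⟩ (fun x y => w x y) (fun x y => R x y) (fun x => h x)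
    (fun x y => hws x y) (fun x y => hwn x y)
    (fun x => by
      rw [Finset.sum_coe_sort Λ (fun y => w x y)]
      exact ((hwS x).1.sum_le_tsum Λ fun y _ => hwn x y).trans (hwS x).2)
    (fun x y => hRs x y) (fun x y => hRn x y) (fun x y => hRle x y) hRo (fun x => hh x) rfl
  set u' : X → ℝ := fun x => if hx : x ∈ Λ then u ⟨x, hx⟩ else 0 with hu'
  have hu : u = fun x : Λ => u' x := by funext x; simp [hu']
  have hQ : ∀ x : Λ, fQ (fun x y : Λ => w x y) u x = pQ w Λ u' x := by
    intro x
    rw [hu]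
    unfold fQ pQ
    rw [Finset.sum_coe_sort Λ (fun y => w x y * (u' x - u' y) ^ 2)]
  simp only [hQ] at h1 h2 h3 h4
  simp only [hu] at h1 h2 h3 h4
  have e1 := Finset.sum_coe_sort Λ (fun x => pQ w Λ u' x ^ q + h x * (u' x ^ 2) ^ q)
  simp only [e1] at h2 h3 h4
  have e2 := fun x => Finset.sum_coe_sort Λ (fun y => R x y * G (u' y))
  simp only [e2] at h1 h4
  have e3 := Finset.sum_coe_sort Λ (fun x => (∑ y ∈ Λ, R x y * G (u' y)) * (g (u' x) * u' x))
  simp only [e3] at h4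
  refine ⟨u', fun _ => ⟨fun x hx => by simp [hu', hx], ?_, h2, h3, h4⟩⟩
  intro z hz
  have := h1 ⟨z, hz⟩
  have e4 := Finset.sum_coe_sort Λ (fun y => w z y * (pQ w Λ u' z ^ (q - 1) + pQ w Λ u' y ^ (q - 1)) * (u' z - u' y))
  simp only at this
  rw [e4] at this
  exact this
end limit

section limit2
variable {X : Type}

lemma summable_w_mul {w : X → ℝ} (hw : Summable w) (hwn : ∀ y, 0 ≤ w y) {c : X → ℝ} {K : ℝ}
    (hc : ∀ y, |c y| ≤ K) : Summable fun y => w y * c y := by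
  refine Summable.of_norm_bounded (g := fun y => w y * K) (hw.mul_right K) fun y => ?_
  rw [Real.norm_eq_abs, abs_mul, abs_of_nonneg (hwn y)]
  exact mul_le_mul_of_nonneg_left (hc y) (hwn y)

lemma sub_sq_le {a c b : ℝ} (ha : |a| ≤ b) (hc : |c| ≤ b) : (a - c) ^ 2 ≤ 4 * b ^ 2 := by
  have := abs_le.1 ha
  have := abs_le.1 hc
  nlinarith [sq_nonneg (a + c)]

lemma limit_exists [DecidableEq X] (o : X) {q θ : ℝ} (hq : 1 ≤ q) (hθ : 2 * q < θ) {g G : ℝ → ℝ}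
    (hNL : NL q θ g G)
    {w R : X → X → ℝ} {h : X → ℝ} {h₀ R₀ S : ℝ} (hh₀ : 0 < h₀) (hR₀ : 0 < R₀) (hS : 0 < S)
    (hws : ∀ x y, w x y = w y x) (hwn : ∀ x y, 0 ≤ w x y) (hwS : ∀ x, Summable (w x) ∧ ∑' y, w x y ≤ S)
    (hRs : ∀ x y, R x y = R y x) (hRn : ∀ x y, 0 ≤ R x y) (hRle : ∀ x y, R x y ≤ R₀)
    (hRo : R o o = R₀) (hh : ∀ x, h₀ ≤ h x) (hh2 : Tendsto h cofinite atTop) :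
    ∃ u : X → ℝ, (∃ x, u x ≠ 0) ∧ (∀ x, Summable fun y => w x y * (u x - u y) ^ 2) ∧
      (Summable fun x => tQ w u x ^ q + h x * (u x ^ 2) ^ q) ∧
      ∀ z, (Summable fun y => w z y * (tQ w u z ^ (q - 1) + tQ w u y ^ (q - 1)) * (u z - u y)) ∧
        (Summable fun y => R z y * G (u y)) ∧
        1 / 2 * ∑' y, w z y * (tQ w u z ^ (q - 1) + tQ w u y ^ (q - 1)) * (u z - u y)
          + h z * ((u z ^ 2) ^ (q - 1) * u z) = (∑' y, R z y * G (u y)) * g (u z) := by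
  have q0 : 0 < q := by linarith
  have q1 : 0 ≤ q - 1 := by linarith
  obtain ⟨c, M, hc, hM, key⟩ := finite_on_finset o hq hθ hNL hh₀ hR₀ hS hws hwn hwS hRs hRn hRle hRo hh
  choose U hU using key
  have Gc : Continuous G := continuous_iff_continuousAt.2 fun t => (hNL.der t).continuousAt
  set l : Ultrafilter (Finset X) := Ultrafilter.of atTop with hl'
  have hl : (l : Filter (Finset X)) ≤ atTop := Ultrafilter.of_le _
  have hmem : ∀ z : X, ∀ᶠ Λ : Finset X in (l : Filter (Finset X)), z ∈ Λ := by
    intro z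
    apply hl
    filter_upwards [eventually_ge_atTop {z}] with Λ hΛ
    exact hΛ (Finset.mem_singleton_self z)
  have hpQn : ∀ Λ u x, 0 ≤ pQ w Λ u x := by
    intro Λ u x
    unfold pQ
    have : 0 ≤ ∑ y ∈ Λ, w x y * (u x - u y) ^ 2 :=
      Finset.sum_nonneg fun y _ => mul_nonneg (hwn x y) (sq_nonneg _)
    linarith
  set b := Real.sqrt ((M / h₀) ^ (1 / q)) with hb
  have b0 : 0 ≤ b := Real.sqrt_nonneg _
  have hterm : ∀ Λ x, 0 ≤ h x * (U Λ x ^ 2) ^ q := fun Λ x =>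
    mul_nonneg (hh₀.le.trans (hh x)) (by positivity)
  have hNle : ∀ᶠ Λ in (l : Filter (Finset X)), ∑ y ∈ Λ, h y * (U Λ y ^ 2) ^ q ≤ M := by
    filter_upwards [hmem o] with Λ ho
    refine le_trans (Finset.sum_le_sum fun x _ => ?_) (hU Λ ho).2.2.1
    have := Real.rpow_nonneg (hpQn Λ (U Λ) x) q
    linarith
  have hUb : ∀ᶠ Λ in (l : Filter (Finset X)), ∀ x, |U Λ x| ≤ b := by
    filter_upwards [hmem o, hNle] with Λ ho hN x
    by_cases hx : x ∈ Λ
    · apply Real.abs_le_sqrt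
      have h1 : h₀ * (U Λ x ^ 2) ^ q ≤ M :=
        calc h₀ * (U Λ x ^ 2) ^ q ≤ h x * (U Λ x ^ 2) ^ q := by have := hh x; gcongr
          _ ≤ _ := Finset.single_le_sum (f := fun x => h x * (U Λ x ^ 2) ^ q) (fun y _ => hterm Λ y) hx
          _ ≤ M := hN
      have h3 : (U Λ x ^ 2) ^ q ≤ M / h₀ := by rw [le_div_iff₀ hh₀]; linarith
      calc U Λ x ^ 2 = ((U Λ x ^ 2) ^ q) ^ (1 / q) := by
            rw [← Real.rpow_mul (sq_nonneg _), mul_one_div_cancel q0.ne', Real.rpow_one]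
        _ ≤ _ := by gcongr
    · rw [(hU Λ ho).1 x hx]; simpa using b0
  have hlim : ∀ x, ∃ a, Tendsto (fun Λ => U Λ x) l (𝓝 a) := by
    intro x
    obtain ⟨a, _, ha⟩ := (isCompact_Icc (a := -b) (b := b)).ultrafilter_le_nhds
      (l.map fun Λ => U Λ x) (by
        rw [le_principal_iff, Ultrafilter.coe_map, Filter.mem_map]
        filter_upwards [hUb] with Λ h
        exact abs_le.1 (h x))
    exact ⟨a, ha⟩
  choose u hu using hlim
  have hub : ∀ x, |u x| ≤ b := fun x => le_of_tendsto (hu x).abs (by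
    filter_upwards [hUb] with Λ h; exact h x)
  have hsq : ∀ x, Summable fun y => w x y * (u x - u y) ^ 2 := fun x =>
    summable_w_mul (hwS x).1 (hwn x) (K := 4 * b ^ 2) fun y => by
      rw [abs_of_nonneg (sq_nonneg _)]; exact sub_sq_le (hub x) (hub y)
  -- convergence of the quadratic forms
  have hQlim : ∀ x, Tendsto (fun Λ => pQ w Λ (U Λ) x) l (𝓝 (tQ w u x)) := by
    intro x
    unfold pQ tQ
    refine Tendsto.const_mul _ ?_
    refine sum_tendsto hl (bound := fun y => w x y * (4 * b ^ 2)) ((hwS x).1.mul_right _) ?_ ?_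
    · intro y
      exact (((hu x).sub (hu y)).pow 2).const_mul _
    · filter_upwards [hUb] with Λ h y
      rw [abs_of_nonneg (mul_nonneg (hwn x y) (sq_nonneg _))]
      exact mul_le_mul_of_nonneg_left (sub_sq_le (h x) (h y)) (hwn x y)
  set Qm := 2 * b ^ 2 * S with hQm
  have hQb : ∀ᶠ Λ in (l : Filter (Finset X)), ∀ x, pQ w Λ (U Λ) x ≤ Qm := by
    filter_upwards [hUb] with Λ h x
    unfold pQ
    have : ∑ y ∈ Λ, w x y * (U Λ x - U Λ y) ^ 2 ≤ S * (4 * b ^ 2) :=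
      calc ∑ y ∈ Λ, w x y * (U Λ x - U Λ y) ^ 2 ≤ ∑ y ∈ Λ, w x y * (4 * b ^ 2) :=
            Finset.sum_le_sum fun y _ => mul_le_mul_of_nonneg_left (sub_sq_le (h x) (h y)) (hwn x y)
        _ = (∑ y ∈ Λ, w x y) * (4 * b ^ 2) := by rw [Finset.sum_mul]
        _ ≤ S * (4 * b ^ 2) := by
            have := ((hwS x).1.sum_le_tsum Λ fun y _ => hwn x y).trans (hwS x).2
            gcongr
    rw [hQm]; linarith
  have htQn : ∀ x, 0 ≤ tQ w u x := fun x => ge_of_tendsto (hQlim x) (Eventually.of_forall fun Λ => hpQn _ _ _)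
  have htQb : ∀ x, tQ w u x ≤ Qm := fun x => le_of_tendsto (hQlim x) (by
    filter_upwards [hQb] with Λ h; exact h x)
  have hcoef : ∀ {A B a c : ℝ}, 0 ≤ A → A ≤ Qm → 0 ≤ B → B ≤ Qm → |a| ≤ b → |c| ≤ b →
      |(A ^ (q - 1) + B ^ (q - 1)) * (a - c)| ≤ (Qm ^ (q - 1) + Qm ^ (q - 1)) * (b + b) := by
    intro A B a c hA hA' hB hB' ha hc
    rw [abs_mul, abs_of_nonneg (by positivity)]
    have : |a - c| ≤ b + b := (abs_sub _ _).trans (add_le_add ha hc)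
    have := hA.trans hA'
    gcongr
  obtain ⟨C, hC, hCb⟩ := hNL.bdd b
  -- convergence of the nonlocal sums
  have htight : ∀ (r : X → ℝ) (r₀ : ℝ), 0 ≤ r₀ → (∀ y, 0 ≤ r y) → (∀ y, r y ≤ r₀) →
      (Summable fun y => r y * G (u y)) ∧
      Tendsto (fun Λ => ∑ y ∈ Λ, r y * G (U Λ y)) l (𝓝 (∑' y, r y * G (u y))) := by
    intro r r₀ hr₀ hrn hrle
    refine tight_tendsto hl (v := fun Λ y => (U Λ y ^ 2) ^ q) (K := r₀ * C) hh₀ hh hh2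
      (by positivity) hM ?_ ?_ ?_ ?_ hNle
    · intro y
      exact ((Gc.tendsto _).comp (hu y)).const_mul _
    · exact Eventually.of_forall fun Λ y => mul_nonneg (hrn y) (hNL.Gnn _)
    · filter_upwards [hUb] with Λ h y
      have h1 := (hCb _ (h y)).1
      have h2 := hrle y
      have h3 := hNL.Gnn (U Λ y)
      rw [mul_assoc]
      gcongr
    · exact Eventually.of_forall fun Λ y => by positivity
  refine ⟨u, ?_, hsq, ?_, ?_⟩
  · by_contra hne
    push Not at hne
    have h1 := (htight (fun _ => 1) 1 zero_le_one (fun _ => zero_le_one) (fun _ => le_rfl)).2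
    simp only [hne, hNL.Gneg 0 le_rfl, mul_zero, tsum_zero, one_mul] at h1
    have h2 : Tendsto (fun Λ => R₀ * (∑ y ∈ Λ, G (U Λ y)) * (C * M / h₀)) l (𝓝 0) := by
      have := (h1.const_mul R₀).mul_const (C * M / h₀)
      simpa using this
    have h3 : c ≤ 0 := by
      refine ge_of_tendsto h2 ?_
      filter_upwards [hmem o, hUb, hNle] with Λ ho hUb hN
      obtain ⟨_, _, _, h5, h6⟩ := hU Λ ho
      rw [h6] at h5
      refine h5.trans ?_
      have hGs : 0 ≤ ∑ y ∈ Λ, G (U Λ y) := Finset.sum_nonneg fun y _ => hNL.Gnn _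
      have hv : ∑ x ∈ Λ, (U Λ x ^ 2) ^ q ≤ M / h₀ := by
        rw [le_div_iff₀ hh₀, Finset.sum_mul]
        refine le_trans (Finset.sum_le_sum fun x _ => ?_) hN
        rw [mul_comm]
        have := hh x
        gcongr
      calc ∑ x ∈ Λ, (∑ y ∈ Λ, R x y * G (U Λ y)) * (g (U Λ x) * U Λ x)
          ≤ ∑ x ∈ Λ, (R₀ * ∑ y ∈ Λ, G (U Λ y)) * (C * (U Λ x ^ 2) ^ q) := by
            refine Finset.sum_le_sum fun x _ => ?_
            have a1 : ∑ y ∈ Λ, R x y * G (U Λ y) ≤ R₀ * ∑ y ∈ Λ, G (U Λ y) := by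
              rw [Finset.mul_sum]
              exact Finset.sum_le_sum fun y _ => mul_le_mul_of_nonneg_right (hRle x y) (hNL.Gnn _)
            have a2 := (hCb _ (hUb x)).2
            have a3 : 0 ≤ g (U Λ x) * U Λ x := by
              rcases le_or_gt (U Λ x) 0 with h | h
              · rw [hNL.gneg _ h]; simp
              · exact mul_nonneg (hNL.gnn _) h.le
            have a4 : 0 ≤ R₀ * ∑ y ∈ Λ, G (U Λ y) := by positivity
            exact mul_le_mul a1 a2 a3 a4
        _ = R₀ * (∑ y ∈ Λ, G (U Λ y)) * (C * ∑ x ∈ Λ, (U Λ x ^ 2) ^ q) := by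
            rw [← Finset.mul_sum, ← Finset.mul_sum]
        _ ≤ R₀ * (∑ y ∈ Λ, G (U Λ y)) * (C * (M / h₀)) := by gcongr
        _ = _ := by rw [mul_div_assoc]
    linarith
  · refine summable_of_sum_le (c := M) (fun x => ?_) fun T => ?_
    · exact add_nonneg (Real.rpow_nonneg (htQn x) q)
        (mul_nonneg (hh₀.le.trans (hh x)) (by positivity))
    · have ht : Tendsto (fun Λ => ∑ x ∈ T, (pQ w Λ (U Λ) x ^ q + h x * (U Λ x ^ 2) ^ q)) l
          (𝓝 (∑ x ∈ T, (tQ w u x ^ q + h x * (u x ^ 2) ^ q))) := by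
        refine tendsto_finsetSum _ fun x _ => ?_
        exact ((hQlim x).rpow_const (Or.inr q0.le)).add
          ((((hu x).pow 2).rpow_const (Or.inr q0.le)).const_mul _)
      refine le_of_tendsto ht ?_
      filter_upwards [hmem o, hl (eventually_ge_atTop T)] with Λ ho hT
      refine le_trans (Finset.sum_le_sum_of_subset_of_nonneg hT fun x _ _ => ?_) (hU Λ ho).2.2.1
      exact add_nonneg (Real.rpow_nonneg (hpQn _ _ x) q) (hterm Λ x)
  · intro z
    refine ⟨?_, (htight (R z) R₀ hR₀.le (hRn z) (hRle z)).1, ?_⟩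
    · simp only [mul_assoc]
      exact summable_w_mul (hwS z).1 (hwn z) fun y =>
        hcoef (htQn z) (htQb z) (htQn y) (htQb y) (hub z) (hub y)
    · have hr := (htight (R z) R₀ hR₀.le (hRn z) (hRle z)).2.mul
        ((hNL.cont.tendsto _).comp (hu z))
      have hs : Tendsto (fun Λ => ∑ y ∈ Λ, w z y *
          (pQ w Λ (U Λ) z ^ (q - 1) + pQ w Λ (U Λ) y ^ (q - 1)) * (U Λ z - U Λ y)) l
          (𝓝 (∑' y, w z y * (tQ w u z ^ (q - 1) + tQ w u y ^ (q - 1)) * (u z - u y))) := by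
        refine sum_tendsto hl (bound := fun y => w z y * ((Qm ^ (q - 1) + Qm ^ (q - 1)) * (b + b)))
          ((hwS z).1.mul_right _) ?_ ?_
        · intro y
          exact ((((hQlim z).rpow_const (Or.inr q1)).add
            ((hQlim y).rpow_const (Or.inr q1))).const_mul _).mul ((hu z).sub (hu y))
        · filter_upwards [hUb, hQb] with Λ h1 h2 y
          rw [mul_assoc, abs_mul, abs_of_nonneg (hwn z y)]
          exact mul_le_mul_of_nonneg_left
            (hcoef (hpQn _ _ _) (h2 z) (hpQn _ _ _) (h2 y) (h1 z) (h1 y)) (hwn z y)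
      have hp : Tendsto (fun Λ => h z * ((U Λ z ^ 2) ^ (q - 1) * U Λ z)) l
          (𝓝 (h z * ((u z ^ 2) ^ (q - 1) * u z))) :=
        ((((hu z).pow 2).rpow_const (Or.inr q1)).mul (hu z)).const_mul _
      refine tendsto_nhds_unique ((hs.const_mul (1 / 2)).add hp) (hr.congr' ?_)
      filter_upwards [hmem o, hmem z] with Λ ho hz
      exact ((hU Λ ho).2.1 z hz).symm
end limit2

section positivity
variable {X : Type}

lemma positive_solution {q θ : ℝ} (hq : 1 ≤ q) {g G : ℝ → ℝ} (hNL : NL q θ g G)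
    {w R : X → X → ℝ} {h : X → ℝ} {h₀ : ℝ} (hh₀ : 0 < h₀)
    (hwn : ∀ x y, 0 ≤ w x y) (hwp : ∀ x y, x ≠ y → 0 < w x y) (hh : ∀ x, h₀ ≤ h x)
    {u : X → ℝ} (hne : ∃ x, u x ≠ 0) (hsq : ∀ x, Summable fun y => w x y * (u x - u y) ^ 2)
    (hsum : Summable fun x => tQ w u x ^ q + h x * (u x ^ 2) ^ q)
    (heq : ∀ z, (Summable fun y => w z y * (tQ w u z ^ (q - 1) + tQ w u y ^ (q - 1)) * (u z - u y)) ∧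
        1 / 2 * ∑' y, w z y * (tQ w u z ^ (q - 1) + tQ w u y ^ (q - 1)) * (u z - u y)
          + h z * ((u z ^ 2) ^ (q - 1) * u z) = (∑' y, R z y * G (u y)) * g (u z)) :
    ∀ x, 0 < u x := by
  have hQn : ∀ x, 0 ≤ tQ w u x := by
    intro x
    unfold tQ
    have : 0 ≤ ∑' y, w x y * (u x - u y) ^ 2 :=
      tsum_nonneg fun y => mul_nonneg (hwn x y) (sq_nonneg _)
    linarith
  have hcn : ∀ x y, 0 ≤ w x y * (tQ w u x ^ (q - 1) + tQ w u y ^ (q - 1)) := fun x y =>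
    mul_nonneg (hwn x y) (add_nonneg (Real.rpow_nonneg (hQn x) _) (Real.rpow_nonneg (hQn y) _))
  have hnn : ∀ x, 0 ≤ u x := by
    by_contra hcon
    push Not at hcon
    obtain ⟨x0, hx0⟩ := hcon
    have hfin : {x | u x ≤ u x0}.Finite := by
      have h1 := hsum.tendsto_cofinite_zero
      have h2 : 0 < h₀ * (u x0 ^ 2) ^ q := by
        have : 0 < u x0 ^ 2 := by nlinarith
        positivity
      have h3 := h1.eventually (gt_mem_nhds h2)
      have h4 : {x | ¬ (tQ w u x ^ q + h x * (u x ^ 2) ^ q < h₀ * (u x0 ^ 2) ^ q)}.Finite := h3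
      refine h4.subset fun x hx => ?_
      simp only [Set.mem_ofPred_eq, not_lt] at hx ⊢
      have h5 : u x0 ^ 2 ≤ u x ^ 2 := by nlinarith
      have h6 := hh x
      have h7 : h₀ * (u x0 ^ 2) ^ q ≤ h x * (u x ^ 2) ^ q := by
        gcongr
        exact hh₀.le.trans h6
      have := Real.rpow_nonneg (hQn x) q
      linarith
    obtain ⟨z, hz, hzmin⟩ := hfin.exists_minimalFor u _ ⟨x0, show u x0 ≤ u x0 from le_rfl⟩
    have hzx : u z ≤ u x0 := hz
    have hmin : ∀ y, u z ≤ u y := by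
      intro y
      rcases le_total (u y) (u x0) with h1 | h1
      · rcases le_total (u z) (u y) with h2 | h2
        · exact h2
        · exact hzmin h1 h2
      · exact hzx.trans h1
    have huz : u z < 0 := hzx.trans_lt hx0
    have h1 := (heq z).2
    rw [hNL.gneg _ huz.le, mul_zero] at h1
    have h2 : ∑' y, w z y * (tQ w u z ^ (q - 1) + tQ w u y ^ (q - 1)) * (u z - u y) ≤ 0 :=
      tsum_nonpos fun y => mul_nonpos_of_nonneg_of_nonpos (hcn z y) (by linarith [hmin y])
    have h3 : h z * ((u z ^ 2) ^ (q - 1) * u z) < 0 := by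
      have : 0 < u z ^ 2 := by nlinarith
      exact mul_neg_of_pos_of_neg (hh₀.trans_le (hh z))
        (mul_neg_of_pos_of_neg (by positivity) huz)
    linarith
  intro z
  refine lt_of_le_of_ne (hnn z) fun hz => ?_
  obtain ⟨x, hx⟩ := hne
  have hxz : z ≠ x := by rintro rfl; exact hx hz.symm
  have hux : 0 < u x := lt_of_le_of_ne (hnn x) (Ne.symm hx)
  have hQz : 0 < tQ w u z := by
    unfold tQ
    have : 0 < ∑' y, w z y * (u z - u y) ^ 2 := by
      refine (hsq z).tsum_pos (fun y => mul_nonneg (hwn z y) (sq_nonneg _)) x ?_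
      rw [← hz]
      have := hwp z x hxz
      simp only [zero_sub, neg_sq]
      positivity
    linarith
  obtain ⟨hs, he⟩ := heq z
  rw [← hz, hNL.gneg 0 le_rfl] at he
  have h1 : 0 < ∑' y, -(w z y * (tQ w u z ^ (q - 1) + tQ w u y ^ (q - 1)) * (u z - u y)) := by
    refine hs.neg.tsum_pos (fun y => ?_) x ?_
    · rw [← mul_neg]
      exact mul_nonneg (hcn z y) (by linarith [hnn y])
    · rw [← mul_neg]
      have a1 := hwp z x hxz
      have a2 := Real.rpow_pos_of_pos hQz (q - 1)
      have a3 := Real.rpow_nonneg (hQn x) (q - 1)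
      refine mul_pos (mul_pos a1 (by linarith)) (by linarith)
  rw [tsum_neg] at h1
  simp only [mul_zero, add_zero] at he
  rw [hz] at he
  linarith
end positivity

lemma offW_mul (W : Z d → Z d → ℝ) (u : Z d → ℝ) (x y : Z d) :
    offW W x y * (u x - u y) = W x y * (u x - u y) := by
  unfold offW
  split_ifs with h
  · subst h; simp
  · rfl

lemma gradNorm_eq (W : Z d → Z d → ℝ) (u : Z d → ℝ) (x : Z d) :
    gradNorm W u x = Real.sqrt (tQ (offW W) u x) := by
  unfold gradNorm tQ
  congr 3
  funext y
  rw [sq, ← mul_assoc, ← mul_assoc, offW_mul]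

lemma sqrt_rpow_eq {t : ℝ} (ht : 0 ≤ t) (r : ℝ) : Real.sqrt t ^ r = t ^ (r / 2) := by
  rw [Real.sqrt_eq_rpow, ← Real.rpow_mul ht]; ring_nf


theorem existence_of_strictly_positive_solution
    {d : ℕ} (hd : 0 < d) {s p : ℝ} (hs : s ∈ Set.Ioo (0 : ℝ) 1) (hp : 2 ≤ p)
    {W : Z d → Z d → ℝ} (hW : KernelOK d s W)
    {α : ℝ} (hα : α ∈ Set.Ioo (0 : ℝ) (d : ℝ))
    {h : Z d → ℝ} {h₀ : ℝ} (hh₀ : 0 < h₀) (hh1 : ∀ x, h₀ ≤ h x)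
    (hh2 : H2 h)
    {f : ℝ → ℝ} (hfc : Continuous f) (hf0 : f 0 = 0)
    (hf1 : F1 f p)
    {C₀ τ : ℝ} (hC₀ : 0 < C₀) (hτ : ((d : ℝ) + α) * p / (2 * d) < τ)
    (hf2 : ∀ t > (0 : ℝ), f t ≤ C₀ * (1 + t ^ (τ - 1)))
    {θ : ℝ} (hθ : p < θ) (hf3 : F3 f θ)
    (hFpos : ∀ t > (0 : ℝ), 0 < Fint f t) :
    ∃ u : Z d → ℝ, (∀ x, 0 < u x) ∧ memH W h p u ∧
      (∀ x : Z d,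
        (Summable fun y : Z d =>
          W x y * (gradNorm W u x ^ (p - 2) + gradNorm W u y ^ (p - 2)) * (u x - u y)) ∧
        (Summable fun y : Z d => Riesz d α x y * Fint f (u y)) ∧
        pLap W p u x + h x * u x ^ (p - 1) =
          conv d α (fun y => Fint f (u y)) x * f (u x)) := by
  obtain ⟨g, G, hNL, hgG⟩ := exists_NL hp hfc hf0 hf1 hθ hf3 hFpos
  obtain ⟨hws, hwn, hwp, S, hS, hwS⟩ := offW_props hd hs.1 hW
  obtain ⟨u, hne, hsq, hsum, heq⟩ := limit_exists (X := Z d) 0 (by linarith : 1 ≤ p / 2)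
    (by linarith : 2 * (p / 2) < θ) hNL hh₀ (riesz_pos hd hα) hS hws hwn hwS
    (fun x y => riesz_symm x y) (fun x y => riesz_nonneg hd hα x y)
    (fun x y => riesz_le hd hα x y) rfl hh1 hh2
  have hpos := positive_solution (by linarith : 1 ≤ p / 2) hNL hh₀ hwn hwp hh1 hne hsq hsum
    (fun z => ⟨(heq z).1, (heq z).2.2⟩)
  have hQn : ∀ x, 0 ≤ tQ (offW W) u x := by
    intro x
    unfold tQ
    have : 0 ≤ ∑' y, offW W x y * (u x - u y) ^ 2 :=
      tsum_nonneg fun y => mul_nonneg (hwn x y) (sq_nonneg _)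
    linarith
  have hg2 : ∀ x, gradNorm W u x ^ (p - 2) = tQ (offW W) u x ^ (p / 2 - 1) := by
    intro x
    rw [gradNorm_eq, sqrt_rpow_eq (hQn x)]
    congr 1; ring
  have hterm : ∀ x y, W x y * (gradNorm W u x ^ (p - 2) + gradNorm W u y ^ (p - 2)) * (u x - u y)
      = offW W x y * (tQ (offW W) u x ^ (p / 2 - 1) + tQ (offW W) u y ^ (p / 2 - 1))
        * (u x - u y) := by
    intro x y
    rw [hg2, hg2, mul_right_comm, ← offW_mul, mul_right_comm]
  have hGu : ∀ y, Fint f (u y) = G (u y) := fun y => ((hgG _ (hpos y)).2).symm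
  refine ⟨u, hpos, ⟨fun x => ?_, ?_⟩, fun x => ⟨?_, ?_, ?_⟩⟩
  · refine (hsq x).congr fun y => ?_
    rw [sq, ← mul_assoc, ← mul_assoc, offW_mul]
  · refine hsum.congr fun x => ?_
    rw [gradNorm_eq, sqrt_rpow_eq (hQn x), abs_of_pos (hpos x), sq_rpow_half (hpos x).le]
    congr 3; ring
  · exact (heq x).1.congr fun y => (hterm x y).symm
  · exact (heq x).2.1.congr fun y => by rw [hGu]
  · have h1 := (heq x).2.2
    unfold pLap conv
    simp only [hterm, hGu]
    rw [← (hgG _ (hpos x)).1, ← h1]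
    congr 2
    rw [sq_rpow_half (hpos x).le, ← Real.rpow_add_one (hpos x).ne']
    congr 1; ring

end DiscreteChoquard
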